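/- arXiv:2009.08191 — 4 statements merged into one kernel-verified Lean document; each statement's English description precedes it below -/
import Mathlib

section
/- Let τ and τ' be permutations of the vectors of F^r fixing 0. For any permutation π of the 2^{r+1} coordinate positions, π maps SQS_τ onto SQS_{τ'} if and only if π maps the code S_τ onto the code S_{τ'}. -/
open Finset

/-- `V r` is the vector space `F^r` over `F = GF(2)`. -/
abbrev V (r : ℕ) : Type := Fin r → ZMod 2

/-- The point set of `SQS_τ` (and the coordinate set of codes of length `2^{r+1}`):
left-half points `({a},∅)` are `Sum.inl a`, right-half points `(∅,{a})` are `Sum.inr a`. -/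
abbrev Pt (r : ℕ) : Type := V r ⊕ V r

/-- Action of a coordinate permutation `π` on a word: `π(y)_i = y_{π⁻¹(i)}`. -/
def permAct {ι : Type} (π : Equiv.Perm ι) (y : ι → ZMod 2) : ι → ZMod 2 :=
  fun i => y (π.symm i)

/-- The extended Hamming code of length `2^r`, with coordinates indexed by the vectors
of `F^r`: all even weight words whose support sums to zero. -/
def extHamming (r : ℕ) : Set (V r → ZMod 2) :=
  {x | ∑ a : V r, x a • a = 0 ∧ ∑ a : V r, x a = 0}

/-- `e_a` : the weight-one word with support `{a}`. -/
def unitVec {r : ℕ} (a : V r) : V r → ZMod 2 :=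
  fun b => if b = a then 1 else 0

/-- The code `S_τ = ⋃_{a ∈ F^r} (H + e_a + e_0) × (H + e_{τ(a)} + e_0)` of length `2^{r+1}`. -/
def Scode {r : ℕ} (τ : Equiv.Perm (V r)) : Set (Pt r → ZMod 2) :=
  ⋃ a : V r, {z | ∃ h₁ ∈ extHamming r, ∃ h₂ ∈ extHamming r,
    z = Sum.elim (h₁ + unitVec a + unitVec 0) (h₂ + unitVec (τ a) + unitVec 0)}

/-- `Q_0` : quadruples `({a,b,c,d},∅)`, `a,b,c,d` pairwise distinct, `a+b+c+d=0`. -/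
def Q0 (r : ℕ) : Set (Finset (Pt r)) :=
  {q | ∃ a b c d : V r, a ≠ b ∧ a ≠ c ∧ a ≠ d ∧ b ≠ c ∧ b ≠ d ∧ c ≠ d ∧
    a + b + c + d = 0 ∧ q = {Sum.inl a, Sum.inl b, Sum.inl c, Sum.inl d}}

/-- `Q_1` : quadruples `(∅,{a,b,c,d})`, `a,b,c,d` pairwise distinct, `a+b+c+d=0`. -/
def Q1 (r : ℕ) : Set (Finset (Pt r)) :=
  {q | ∃ a b c d : V r, a ≠ b ∧ a ≠ c ∧ a ≠ d ∧ b ≠ c ∧ b ≠ d ∧ c ≠ d ∧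
    a + b + c + d = 0 ∧ q = {Sum.inr a, Sum.inr b, Sum.inr c, Sum.inr d}}

/-- `Q_τ` : quadruples `({a,c},{b,d})` with `τ(a+c) = b+d ≠ 0`. -/
def Qt {r : ℕ} (τ : Equiv.Perm (V r)) : Set (Finset (Pt r)) :=
  {q | ∃ a b c d : V r, τ (a + c) = b + d ∧ b + d ≠ 0 ∧
    q = {Sum.inl a, Sum.inl c, Sum.inr b, Sum.inr d}}

/-- The Steiner quadruple system `SQS_τ = Q_0 ∪ Q_1 ∪ Q_τ`. -/
def SQS {r : ℕ} (τ : Equiv.Perm (V r)) : Set (Finset (Pt r)) :=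
  Q0 r ∪ Q1 r ∪ Qt τ

/-- Action of a point bijection on a set system. -/
def qAct {α β : Type} [DecidableEq β] (π : α ≃ β) (Q : Set (Finset α)) : Set (Finset β) :=
  (fun q => q.image π) '' Q

/-- All quadruples of the system `Q` containing both points `p` and `p'`. -/
def quadsThrough {r : ℕ} (Q : Set (Finset (Pt r))) (p p' : Pt r) : Set (Finset (Pt r)) :=
  {q ∈ Q | p ∈ q ∧ p' ∈ q}

/-- The affine permutation `σ_{a,A} : b ↦ a + A b` of `F^r`, where `A ∈ GL(r,2)`. -/
def affEquiv {r : ℕ} (a : V r) (A : V r ≃ₗ[ZMod 2] V r) : Equiv.Perm (V r) :=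
  A.toEquiv.trans (Equiv.addLeft a)

/-- The permutation `ξ` swapping `({a},∅)` with `(∅,{a})` for every `a`. -/
def xi (r : ℕ) : Equiv.Perm (Pt r) := Equiv.sumComm (V r) (V r)

/-- Point transitivity of the Steiner quadruple system `SQS_τ`. -/
def SQSPointTransitive {r : ℕ} (τ : Equiv.Perm (V r)) : Prop :=
  ∀ p p' : Pt r, ∃ π : Equiv.Perm (Pt r), qAct π (SQS τ) = SQS τ ∧ π p = p'

/-- A code is transitive if (a subgroup of) its automorphism group acts transitively
on its codewords: any codeword is mapped to any other by an automorphism `y ↦ x + π(y)`. -/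
def IsTransitiveCode {ι : Type} (C : Set (ι → ZMod 2)) : Prop :=
  ∀ c ∈ C, ∀ c' ∈ C, ∃ (x : ι → ZMod 2) (π : Equiv.Perm ι),
    (fun y => x + permAct π y) '' C = C ∧ x + permAct π c = c'

/-- A code is coordinate transitive if `PAut(C)` acts transitively on coordinates. -/
def CoordTransitive {ι : Type} (C : Set (ι → ZMod 2)) : Prop :=
  ∀ i j : ι, ∃ π : Equiv.Perm ι, permAct π '' C = C ∧ π i = j

/-- `C_1` : the words at Hamming distance exactly 1 from the code `C`. -/
def codeNbrs {ι : Type} [Fintype ι] (C : Set (ι → ZMod 2)) : Set (ι → ZMod 2) :=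
  {y | y ∉ C ∧ ∃ c ∈ C, hammingDist y c = 1}

/-- A code is neighbor transitive if `Aut(C)` acts transitively both on `C` and on `C_1`. -/
def NeighborTransitive {ι : Type} [Fintype ι] (C : Set (ι → ZMod 2)) : Prop :=
  IsTransitiveCode C ∧
  ∀ y ∈ codeNbrs C, ∀ y' ∈ codeNbrs C, ∃ (x : ι → ZMod 2) (π : Equiv.Perm ι),
    (fun w => x + permAct π w) '' C = C ∧ x + permAct π y = y'

/-- An extended perfect code: minimum distance 4 and `2^n/(2n)` codewords. -/
def IsExtPerfect {ι : Type} [Fintype ι] (C : Set (ι → ZMod 2)) : Prop :=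
  (∀ x ∈ C, ∀ y ∈ C, x ≠ y → 4 ≤ hammingDist x y) ∧
  (∃ x ∈ C, ∃ y ∈ C, hammingDist x y = 4) ∧
  Nat.card C * (2 * Fintype.card ι) = 2 ^ Fintype.card ι

/-- The (extended) Mollard code `M(C,D)` with function `φ`. -/
def mollard {t m : ℕ} (C : Set (Fin t → ZMod 2)) (D : Set (Fin m → ZMod 2))
    (φ : (Fin t → ZMod 2) → (Fin m → ZMod 2)) : Set (Fin t × Fin m → ZMod 2) :=
  {z | (fun i => ∑ j, z (i, j)) ∈ C ∧
       ∃ d ∈ D, (fun j => ∑ i, z (i, j)) = φ (fun i => ∑ j, z (i, j)) + d}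

/-- Isomorphism of codes over possibly different coordinate sets:
`D = x + π(C)` for a coordinate bijection `π` and a vector `x`. -/
def CodeIso {ι κ : Type} (C : Set (ι → ZMod 2)) (D : Set (κ → ZMod 2)) : Prop :=
  ∃ (e : ι ≃ κ) (x : κ → ZMod 2), (fun z => x + fun k => z (e.symm k)) '' C = D

/-- The rank of a code: the dimension of its linear span. -/
noncomputable def codeRank {ι : Type} (C : Set (ι → ZMod 2)) : ℕ :=
  Module.finrank (ZMod 2) ↥(Submodule.span (ZMod 2) C)

/-- The kernel of a code: `{x : x + C = C}`. -/
def codeKernel {ι : Type} (C : Set (ι → ZMod 2)) : Set (ι → ZMod 2) :=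
  {x | (fun y => x + y) '' C = C}

/-- The dimension of the kernel of a code. -/
noncomputable def kernelDim {ι : Type} (C : Set (ι → ZMod 2)) : ℕ :=
  codeRank (codeKernel C)

/-- A permutation of `F^r` is affine if it is of the form `b ↦ a + A b`, `A ∈ GL(r,2)`. -/
def IsAffinePerm {r : ℕ} (g : Equiv.Perm (V r)) : Prop :=
  ∃ (a : V r) (A : V r ≃ₗ[ZMod 2] V r), ∀ x, g x = a + A x

/-- A regular subgroup of `GA(r,2)`: a subgroup consisting of affine permutations that
acts sharply transitively on `F^r`. -/
def IsRegularAffineSubgroup {r : ℕ} (G : Subgroup (Equiv.Perm (V r))) : Prop :=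
  (∀ g ∈ G, IsAffinePerm g) ∧ ∀ u v : V r, ∃! g : G, (g : Equiv.Perm (V r)) u = v

/-- `τ` is induced by an automorphism `T` of a regular subgroup `G ≤ GA(r,2)`:
`T(g_a) = g_{τ(a)}`, i.e. `τ(g(0)) = (T g)(0)` for every `g ∈ G`. -/
def InducedByRegularAut {r : ℕ} (τ : Equiv.Perm (V r)) : Prop :=
  ∃ G : Subgroup (Equiv.Perm (V r)), IsRegularAffineSubgroup G ∧
    ∃ T : G ≃* G, ∀ g : G, τ ((g : Equiv.Perm (V r)) 0) = (T g : Equiv.Perm (V r)) 0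

/-- The identification `F^{r+r'} ≃ F^r × F^{r'}`, `x|y ↦ (x,y)`. -/
def splitEquiv (r r' : ℕ) : V (r + r') ≃ V r × V r' :=
  (finSumFinEquiv.symm.arrowCongr (Equiv.refl (ZMod 2))).trans
    (Equiv.sumArrowEquivProdArrow _ _ _)

/-- The concatenation `τ|τ'` of permutations: `(τ|τ')(x|y) = τ(x)|τ'(y)`. -/
def concatPerm {r r' : ℕ} (τ : Equiv.Perm (V r)) (τ' : Equiv.Perm (V r')) :
    Equiv.Perm (V (r + r')) :=
  (splitEquiv r r').trans ((τ.prodCongr τ').trans (splitEquiv r r').symm)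

namespace SQSProof

variable {r : ℕ}

def syn (x : V r → ZMod 2) : V r := ∑ a : V r, x a • a
def par (x : V r → ZMod 2) : ZMod 2 := ∑ a : V r, x a

lemma syn_add (x y : V r → ZMod 2) : syn (x + y) = syn x + syn y := by
  simp [syn, add_smul, Finset.sum_add_distrib]
lemma par_add (x y : V r → ZMod 2) : par (x + y) = par x + par y := by
  simp [par, Finset.sum_add_distrib]
lemma syn_unit (a : V r) : syn (unitVec a) = a := by
  simp [syn, unitVec]
lemma par_unit (a : V r) : par (unitVec a) = 1 := by
  simp [par, unitVec]
lemma syn_zero : syn (0 : V r → ZMod 2) = 0 := by simp [syn]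
lemma par_zero : par (0 : V r → ZMod 2) = 0 := by simp [par]

lemma two {M : Type*} [AddCommGroup M] [Module (ZMod 2) M] (a : M) : a + a = 0 :=
  ZModModule.add_self a

lemma eq_iff {M : Type*} [AddCommGroup M] [Module (ZMod 2) M] (a b : M) :
    a = b ↔ a + b = 0 := by
  constructor
  · rintro rfl; exact two a
  · intro h
    have : a + b + b = 0 + b := by rw [h]
    rwa [add_assoc, two, add_zero, zero_add] at this

def inS (τ : Equiv.Perm (V r)) (z : Pt r → ZMod 2) : Prop :=
  par (z ∘ Sum.inl) = 0 ∧ par (z ∘ Sum.inr) = 0 ∧ τ (syn (z ∘ Sum.inl)) = syn (z ∘ Sum.inr)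

lemma mem_ext (x : V r → ZMod 2) : x ∈ extHamming r ↔ syn x = 0 ∧ par x = 0 := Iff.rfl

lemma mem_S (τ : Equiv.Perm (V r)) (z : Pt r → ZMod 2) : z ∈ Scode τ ↔ inS τ z := by
  simp only [Scode, Set.mem_iUnion, Set.mem_ofPred_eq, inS]
  constructor
  · rintro ⟨a, h₁, m₁, h₂, m₂, rfl⟩
    rw [mem_ext] at m₁ m₂
    simp only [Sum.elim_comp_inl, Sum.elim_comp_inr, par_add, syn_add, par_unit, syn_unit, m₁, m₂]
    refine ⟨by decide, by decide, by simp⟩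
  · rintro ⟨h1, h2, h3⟩
    refine ⟨syn (z ∘ Sum.inl), z ∘ Sum.inl + unitVec (syn (z ∘ Sum.inl)) + unitVec 0, ?_,
      z ∘ Sum.inr + unitVec (syn (z ∘ Sum.inr)) + unitVec 0, ?_, ?_⟩
    · rw [mem_ext]
      simp only [par_add, syn_add, par_unit, syn_unit, h1, add_zero, two]
      decide
    · rw [mem_ext]
      simp only [par_add, syn_add, par_unit, syn_unit, h2, add_zero, two]
      decide
    · have key : ∀ x u v : V r → ZMod 2, x + u + v + u + v = x := by
        intro x u v
        have : x + u + v + u + v = x + (u + u) + (v + v) := by abel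
        rw [this, two, two, add_zero, add_zero]
      rw [h3, key, key]
      exact (Sum.elim_comp_inl_inr z).symm

lemma zcases (a : ZMod 2) : a = 0 ∨ a = 1 := by revert a; decide

lemma par_eq_norm (x : V r → ZMod 2) : par x = (hammingNorm x : ZMod 2) := by
  rw [hammingNorm, Finset.card_filter, par]
  push_cast
  refine Finset.sum_congr rfl fun i _ => ?_
  rcases zcases (x i) with h | h <;> simp [h]

lemma norm_even {x : V r → ZMod 2} (h : par x = 0) : Even (hammingNorm x) := by
  rw [par_eq_norm] at h
  exact (ZMod.natCast_eq_zero_iff_even).1 h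

lemma norm_split (z : Pt r → ZMod 2) :
    hammingNorm z = hammingNorm (z ∘ Sum.inl) + hammingNorm (z ∘ Sum.inr) := by
  simp only [hammingNorm, Finset.card_filter, Fintype.sum_sum_type, Function.comp]

def ind {ι : Type} [DecidableEq ι] (q : Finset ι) : ι → ZMod 2 := fun i => if i ∈ q then 1 else 0

lemma ind_norm {ι : Type} [DecidableEq ι] [Fintype ι] (q : Finset ι) :
    hammingNorm (ind q) = q.card := by
  simp [hammingNorm, ind]

lemma ind_inj {ι : Type} [DecidableEq ι] {p q : Finset ι} (h : ind p = ind q) : p = q := by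
  ext i
  have := congrFun h i
  simp only [ind] at this
  by_cases h1 : i ∈ p <;> by_cases h2 : i ∈ q <;> simp_all

lemma ind_surj {ι : Type} [DecidableEq ι] [Fintype ι] (z : ι → ZMod 2) :
    ∃ q : Finset ι, ind q = z := by
  refine ⟨Finset.univ.filter (fun i => z i ≠ 0), ?_⟩
  funext i
  rcases zcases (z i) with h | h <;> simp [ind, h]

lemma ind_insert {ι : Type} [DecidableEq ι] {q : Finset ι} {a : ι} (h : a ∉ q) :
    ind (insert a q) = Pi.single a 1 + ind q := by
  funext i
  by_cases hi : i = a
  · subst hi; simp [ind, h]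
  · simp [ind, hi]

lemma ind_empty {ι : Type} [DecidableEq ι] : ind (∅ : Finset ι) = 0 := by
  funext i; simp [ind]

lemma ind_singleton {ι : Type} [DecidableEq ι] (a : ι) : ind {a} = Pi.single a 1 := by
  funext i; by_cases hi : i = a
  · subst hi; simp [ind]
  · simp [ind, hi]

lemma single_eq (a : V r) : (Pi.single a 1 : V r → ZMod 2) = unitVec a := by
  funext i; by_cases hi : i = a
  · subst hi; simp [unitVec]
  · simp [unitVec, hi]

lemma norm_two {x : V r → ZMod 2} (h : hammingNorm x = 2) :
    ∃ a b, a ≠ b ∧ x = unitVec a + unitVec b := by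
  obtain ⟨q, rfl⟩ := ind_surj x
  rw [ind_norm] at h
  obtain ⟨a, b, hab, rfl⟩ := Finset.card_eq_two.1 h
  refine ⟨a, b, hab, ?_⟩
  rw [ind_insert (by simpa using hab), ind_singleton, single_eq, single_eq]

/-- the left/right embedding of words -/
def el (x : V r → ZMod 2) : Pt r → ZMod 2 := Sum.elim x 0
def er (x : V r → ZMod 2) : Pt r → ZMod 2 := Sum.elim 0 x

lemma ind_inl (q : Finset (V r)) : ind (q.image (Sum.inl : V r → Pt r)) = Sum.elim (ind q) 0 := by
  funext i; rcases i with i | i <;> simp [ind]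
lemma ind_inr (q : Finset (V r)) : ind (q.image (Sum.inr : V r → Pt r)) = Sum.elim (0 : V r → ZMod 2) (ind q) := by
  funext i; rcases i with i | i <;> simp [ind]
lemma ind_both (p q : Finset (V r)) :
    ind (p.image (Sum.inl : V r → Pt r) ∪ q.image Sum.inr) = Sum.elim (ind p) (ind q) := by
  funext i; rcases i with i | i <;> simp [ind]

lemma ind_quad {a b c d : V r} (h1 : a ≠ b) (h2 : a ≠ c) (h3 : a ≠ d) (h4 : b ≠ c) (h5 : b ≠ d)
    (h6 : c ≠ d) :
    ind {a, b, c, d} = unitVec a + (unitVec b + (unitVec c + unitVec d)) := by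
  rw [ind_insert (by simp [*]), ind_insert (by simp [*]), ind_insert (by simp [*]), ind_singleton]
  simp only [single_eq]

lemma ind_pair {a b : V r} (h1 : a ≠ b) : ind {a, b} = unitVec a + unitVec b := by
  rw [ind_insert (by simp [*]), ind_singleton]
  simp only [single_eq]

lemma card_quad {α : Type*} [DecidableEq α] {a b c d : α} (h1 : a ≠ b) (h2 : a ≠ c) (h3 : a ≠ d)
    (h4 : b ≠ c) (h5 : b ≠ d) (h6 : c ≠ d) : ({a, b, c, d} : Finset α).card = 4 := by
  rw [Finset.card_insert_of_notMem (by simp [*]), Finset.card_insert_of_notMem (by simp [*]),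
    Finset.card_pair h6]

lemma card_eq_four {α : Type*} [DecidableEq α] {q : Finset α} (h : q.card = 4) :
    ∃ a b c d, a ≠ b ∧ a ≠ c ∧ a ≠ d ∧ b ≠ c ∧ b ≠ d ∧ c ≠ d ∧ q = {a, b, c, d} := by
  obtain ⟨a, t, hat, rfl, ht⟩ := Finset.card_eq_succ.1 h
  obtain ⟨b, c, d, h1, h2, h3, rfl⟩ := Finset.card_eq_three.1 ht
  simp only [Finset.mem_insert, Finset.mem_singleton, not_or] at hat
  exact ⟨a, b, c, d, hat.1, hat.2.1, hat.2.2, h1, h2, h3, rfl⟩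

lemma one4 : (1 : ZMod 2) + (1 + (1 + 1)) = 0 := by decide
lemma one2 : (1 : ZMod 2) + 1 = 0 := by decide

lemma mem_SQS (τ : Equiv.Perm (V r)) (h0 : τ 0 = 0) (q : Finset (Pt r)) :
    q ∈ SQS τ ↔ q.card = 4 ∧ inS τ (ind q) := by
  constructor
  · rintro ((⟨a, b, c, d, h1, h2, h3, h4, h5, h6, hs, rfl⟩ |
      ⟨a, b, c, d, h1, h2, h3, h4, h5, h6, hs, rfl⟩) | ⟨a, b, c, d, hs, hn, rfl⟩)
    · refine ⟨card_quad (by simp [*]) (by simp [*]) (by simp [*]) (by simp [*]) (by simp [*])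
        (by simp [*]), ?_⟩
      have : ({Sum.inl a, Sum.inl b, Sum.inl c, Sum.inl d} : Finset (Pt r)) =
        ({a, b, c, d} : Finset (V r)).image Sum.inl := by simp
      rw [this, ind_inl, ind_quad h1 h2 h3 h4 h5 h6]
      simp only [inS, Sum.elim_comp_inl, Sum.elim_comp_inr, par_add, syn_add, par_unit, syn_unit,
        par_zero, syn_zero, one4, true_and]
      rw [← add_assoc, ← add_assoc, hs, h0]
    · refine ⟨card_quad (by simp [*]) (by simp [*]) (by simp [*]) (by simp [*]) (by simp [*])
        (by simp [*]), ?_⟩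
      have : ({Sum.inr a, Sum.inr b, Sum.inr c, Sum.inr d} : Finset (Pt r)) =
        ({a, b, c, d} : Finset (V r)).image Sum.inr := by simp
      rw [this, ind_inr, ind_quad h1 h2 h3 h4 h5 h6]
      simp only [inS, Sum.elim_comp_inl, Sum.elim_comp_inr, par_add, syn_add, par_unit, syn_unit,
        par_zero, syn_zero, one4, true_and]
      rw [← add_assoc, ← add_assoc, hs, h0]
    · have hbd : b ≠ d := fun h => hn ((eq_iff _ _).1 h)
      have hac : a ≠ c := by
        intro h
        rw [(eq_iff _ _).1 h, h0] at hs
        exact hn hs.symm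
      refine ⟨card_quad (by simp [*]) (by simp [*]) (by simp [*]) (by simp [*]) (by simp [*])
        (by simp [*]), ?_⟩
      have : ({Sum.inl a, Sum.inl c, Sum.inr b, Sum.inr d} : Finset (Pt r)) =
        ({a, c} : Finset (V r)).image Sum.inl ∪ ({b, d} : Finset (V r)).image Sum.inr := by
        ext i; simp; tauto
      rw [this, ind_both, ind_pair hbd, ind_pair hac]
      simp only [inS, Sum.elim_comp_inl, Sum.elim_comp_inr, par_add, syn_add, par_unit, syn_unit,
        one2, true_and]
      exact hs
  · rintro ⟨hc, hS⟩
    obtain ⟨A, hA⟩ := ind_surj (ind q ∘ Sum.inl)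
    obtain ⟨B, hB⟩ := ind_surj (ind q ∘ Sum.inr)
    have hq : q = A.image Sum.inl ∪ B.image Sum.inr := by
      apply ind_inj
      rw [ind_both, hA, hB, Sum.elim_comp_inl_inr]
    obtain ⟨s1, s2, s3⟩ := hS
    have e1 := norm_even s1
    have e2 := norm_even s2
    have e3 := norm_split (ind q)
    rw [ind_norm, hc] at e3
    rw [← hA] at s1 s3 e1 e3
    rw [← hB] at s2 s3 e2 e3
    rw [ind_norm] at e1 e2
    rw [ind_norm, ind_norm] at e3
    have : (A.card = 4 ∧ B.card = 0) ∨ (A.card = 0 ∧ B.card = 4) ∨ (A.card = 2 ∧ B.card = 2) := by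
      obtain ⟨m, hm⟩ := e1
      obtain ⟨n, hn⟩ := e2
      omega
    rcases this with ⟨cA, cB⟩ | ⟨cA, cB⟩ | ⟨cA, cB⟩
    · left; left
      obtain ⟨a, b, c, d, h1, h2, h3, h4, h5, h6, rfl⟩ := card_eq_four cA
      rw [Finset.card_eq_zero] at cB
      subst cB
      refine ⟨a, b, c, d, h1, h2, h3, h4, h5, h6, ?_, by rw [hq]; simp⟩
      rw [ind_quad h1 h2 h3 h4 h5 h6, ind_empty, syn_zero, ← h0, τ.apply_eq_iff_eq] at s3
      simpa only [syn_add, syn_unit, ← add_assoc] using s3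
    · left; right
      obtain ⟨a, b, c, d, h1, h2, h3, h4, h5, h6, rfl⟩ := card_eq_four cB
      rw [Finset.card_eq_zero] at cA
      subst cA
      refine ⟨a, b, c, d, h1, h2, h3, h4, h5, h6, ?_, by rw [hq]; simp⟩
      rw [ind_quad h1 h2 h3 h4 h5 h6, ind_empty, syn_zero, h0] at s3
      simpa only [syn_add, syn_unit, ← add_assoc] using s3.symm
    · right
      obtain ⟨a, c, hac, rfl⟩ := Finset.card_eq_two.1 cA
      obtain ⟨b, d, hbd, rfl⟩ := Finset.card_eq_two.1 cB
      refine ⟨a, b, c, d, ?_, fun h => hbd ((eq_iff _ _).2 h), by rw [hq]; ext i; simp; tauto⟩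
      rw [ind_pair hac, ind_pair hbd] at s3
      simpa only [syn_add, syn_unit] using s3

lemma permAct_ind (π : Equiv.Perm (Pt r)) (q : Finset (Pt r)) :
    permAct π (ind q) = ind (q.image π) := by
  funext i
  simp only [permAct, ind, Finset.mem_image]
  congr 1
  apply propext
  constructor
  · intro h; exact ⟨_, h, by simp⟩
  · rintro ⟨j, hj, rfl⟩; simpa using hj

lemma permAct_add (π : Equiv.Perm (Pt r)) (x y : Pt r → ZMod 2) :
    permAct π (x + y) = permAct π x + permAct π y := rfl

lemma permAct_norm (π : Equiv.Perm (Pt r)) (x : Pt r → ZMod 2) :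
    hammingNorm (permAct π x) = hammingNorm x := by
  obtain ⟨q, rfl⟩ := ind_surj x
  rw [permAct_ind, ind_norm, ind_norm, Finset.card_image_of_injective _ π.injective]

lemma permAct_symm (π : Equiv.Perm (Pt r)) (x : Pt r → ZMod 2) :
    permAct π (permAct π.symm x) = x := by
  funext i; simp [permAct]
lemma permAct_symm' (π : Equiv.Perm (Pt r)) (x : Pt r → ZMod 2) :
    permAct π.symm (permAct π x) = x := by
  funext i; simp [permAct]

/-- A weight-4 codeword that is good lies in the kernel. -/
lemma good_ker (τ : Equiv.Perm (V r)) (h0 : τ 0 = 0) {q : Pt r → ZMod 2} (hq : inS τ q)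
    (hw : hammingNorm q = 4)
    (hg : ∀ p, inS τ p → hammingNorm p = 4 → hammingNorm (p + q) = 4 → inS τ (p + q)) :
    ∀ z, inS τ z → inS τ (z + q) := by
  obtain ⟨x, y, rfl⟩ : ∃ x y, q = Sum.elim x y := ⟨_, _, (Sum.elim_comp_inl_inr q).symm⟩
  obtain ⟨q1, q2, q3⟩ := hq
  rw [norm_split] at hw
  simp only [Sum.elim_comp_inl, Sum.elim_comp_inr] at q1 q2 q3 hw
  have key : ∀ w, τ (w + syn x) = τ w + τ (syn x) := by
    by_cases hu : syn x = 0
    · intro w; rw [hu, h0, add_zero, add_zero]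
    have hv : syn y ≠ 0 := by
      rw [← q3, ← h0]; exact fun h => hu (τ.injective h)
    have nx : hammingNorm x ≠ 0 := by
      intro h; rw [hammingNorm_eq_zero] at h; exact hu (by rw [h, syn_zero])
    have ny : hammingNorm y ≠ 0 := by
      intro h; rw [hammingNorm_eq_zero] at h; exact hv (by rw [h, syn_zero])
    obtain ⟨m, hm⟩ := norm_even q1
    obtain ⟨n, hn⟩ := norm_even q2
    obtain ⟨a, c, hac, rfl⟩ := norm_two (x := x) (by omega)
    obtain ⟨b, d, hbd, rfl⟩ := norm_two (x := y) (by omega)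
    simp only [syn_add, syn_unit] at *
    intro w
    by_cases hw0 : w = 0
    · rw [hw0, h0, zero_add, zero_add]
    by_cases hwu : w = a + c
    · rw [hwu, two, two, h0]
    have ht0 : τ w ≠ 0 := by
      intro h; rw [← h0] at h; exact hw0 (τ.injective h)
    have htu : τ w ≠ b + d := by
      intro h; rw [← q3] at h; exact hwu (τ.injective h)
    have E : ∀ a c w : V r, unitVec a + unitVec (a + w) + (unitVec a + unitVec c)
        = unitVec c + unitVec (a + w) := by
      intro a c w
      have : unitVec a + unitVec (a + w) + (unitVec a + unitVec c)
        = (unitVec a + unitVec a) + (unitVec c + unitVec (a + w)) := by abel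
      rw [this, two, zero_add]
    have N : ∀ a b : V r, a ≠ b → hammingNorm (unitVec a + unitVec b) = 2 := by
      intro a b hab
      rw [← ind_pair hab, ind_norm, Finset.card_pair hab]
    have D : ∀ a c w : V r, w ≠ a + c → c ≠ a + w := by
      rintro a c w h rfl
      apply h
      rw [← add_assoc, two, zero_add]
    have F : (Sum.elim (unitVec a + unitVec (a + w)) (unitVec b + unitVec (b + τ w)) : Pt r → ZMod 2)
        + Sum.elim (unitVec a + unitVec c) (unitVec b + unitVec d)
        = Sum.elim (unitVec c + unitVec (a + w)) (unitVec d + unitVec (b + τ w)) := by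
      rw [← E a c w, ← E b d (τ w)]
      funext i; rcases i with i | i <;> rfl
    have G := hg (Sum.elim (unitVec a + unitVec (a + w)) (unitVec b + unitVec (b + τ w))) ?_ ?_ ?_
    · rw [F] at G
      have := G.2.2
      simp only [Sum.elim_comp_inl, Sum.elim_comp_inr, syn_add, syn_unit] at this
      have e1 : w + (a + c) = c + (a + w) := by abel
      rw [q3, e1, this]
      abel
    · simp only [inS, Sum.elim_comp_inl, Sum.elim_comp_inr, par_add, syn_add, par_unit, syn_unit,
        one2, true_and]
      rw [← add_assoc, ← add_assoc, two, two, zero_add, zero_add]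
    · rw [norm_split, Sum.elim_comp_inl, Sum.elim_comp_inr, N _ _ (by simpa using hw0),
        N _ _ (by simpa using ht0)]
    · rw [F, norm_split, Sum.elim_comp_inl, Sum.elim_comp_inr, N _ _ (D _ _ _ hwu),
        N _ _ (D _ _ _ htu)]
  rintro z ⟨z1, z2, z3⟩
  have c1 : (z + Sum.elim x y) ∘ Sum.inl = z ∘ Sum.inl + x := rfl
  have c2 : (z + Sum.elim x y) ∘ Sum.inr = z ∘ Sum.inr + y := rfl
  refine ⟨?_, ?_, ?_⟩
  · rw [c1, par_add, z1, q1, add_zero]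
  · rw [c2, par_add, z2, q2, add_zero]
  · rw [c1, c2, syn_add, syn_add, key, z3, q3]

/-- three points of the support of a word give a Hamming word of weight 4 reducing the weight -/
lemma reduce (x : V r → ZMod 2) (h : 2 < hammingNorm x) :
    ∃ h : V r → ZMod 2, par h = 0 ∧ syn h = 0 ∧ hammingNorm h = 4 ∧
      hammingNorm (x + h) < hammingNorm x := by
  obtain ⟨q, rfl⟩ := ind_surj x
  rw [ind_norm] at h
  obtain ⟨a, b, c, ha, hb, hc, hab, hac, hbc⟩ := Finset.two_lt_card_iff.1 h
  have h3 : a ≠ a + b + c := by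
    intro h
    rw [add_assoc, left_eq_add] at h
    exact hbc ((eq_iff _ _).2 h)
  have h5 : b ≠ a + b + c := by
    intro h
    rw [add_comm a b, add_assoc, left_eq_add] at h
    exact hac ((eq_iff _ _).2 h)
  have h6 : c ≠ a + b + c := by
    intro h
    rw [right_eq_add] at h
    exact hab ((eq_iff _ _).2 h)
  refine ⟨ind {a, b, c, a + b + c}, ?_, ?_, ?_, ?_⟩
  · rw [ind_quad hab hac h3 hbc h5 h6]
    simp only [par_add, par_unit, one4]
  · rw [ind_quad hab hac h3 hbc h5 h6]
    simp only [syn_add, syn_unit]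
    rw [← add_assoc, ← add_assoc, two]
  · rw [ind_norm, card_quad hab hac h3 hbc h5 h6]
  · rw [ind_norm]
    have hsub : hammingNorm (ind q + ind {a, b, c, a + b + c}) ≤
        (insert (a + b + c) (q \ {a, b, c})).card := by
      unfold hammingNorm
      apply Finset.card_le_card
      intro i
      simp only [Finset.mem_filter, Finset.mem_univ, true_and, Pi.add_apply, ind,
        Finset.mem_insert, Finset.mem_singleton, Finset.mem_sdiff]
      intro hi
      by_cases e1 : i = a + b + c
      · exact Or.inl e1
      right
      by_cases e2 : i = a ∨ i = b ∨ i = c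
      · exfalso
        apply hi
        have : i ∈ q := by rcases e2 with rfl | rfl | rfl <;> assumption
        rw [if_pos this, if_pos (by tauto)]
        exact one2
      · refine ⟨?_, e2⟩
        by_contra hiq
        apply hi
        rw [if_neg hiq, if_neg (by tauto)]
        exact add_zero 0
    have h1 := Finset.card_insert_le (a + b + c) (q \ {a, b, c})
    have h2 : (q \ {a, b, c}).card = q.card - 3 := by
      rw [Finset.card_sdiff_of_subset]
      · rw [Finset.card_eq_three.2 ⟨a, b, c, hab, hac, hbc, rfl⟩]
      · intro i; simp only [Finset.mem_insert, Finset.mem_singleton]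
        rintro (rfl | rfl | rfl) <;> assumption
    omega

lemma add_cancel (z q : Pt r → ZMod 2) : z + q + q = z := by
  rw [add_assoc, two, add_zero]

lemma transfer (τ τ' : Equiv.Perm (V r)) (h0 : τ 0 = 0) (h0' : τ' 0 = 0) (π : Equiv.Perm (Pt r))
    (H : ∀ z, hammingNorm z = 4 → (inS τ z ↔ inS τ' (permAct π z))) :
    ∀ z, inS τ z → inS τ' (permAct π z) := by
  have zeroS : ∀ (τ : Equiv.Perm (V r)), τ 0 = 0 → inS τ 0 := by
    intro τ h
    have c1 : (0 : Pt r → ZMod 2) ∘ Sum.inl = 0 := rfl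
    have c2 : (0 : Pt r → ZMod 2) ∘ Sum.inr = 0 := rfl
    simp only [inS, c1, c2, par_zero, syn_zero, h, and_self]
  have K : ∀ q, hammingNorm q = 4 → (∀ z, inS τ z → inS τ (z + q)) →
      ∀ z, inS τ' z → inS τ' (z + permAct π q) := by
    intro q hw hk
    have hq : inS τ q := by simpa using hk 0 (zeroS τ h0)
    refine good_ker τ' h0' ((H q hw).1 hq) (by rw [permAct_norm, hw]) ?_
    intro p hp hpw hpq
    obtain ⟨p, rfl⟩ : ∃ p', p = permAct π p' := ⟨_, (permAct_symm π p).symm⟩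
    rw [← permAct_add] at hpq ⊢
    rw [permAct_norm] at hpw hpq
    exact (H _ hpq).1 (hk _ ((H p hpw).2 hp))
  have step : ∀ q, hammingNorm q = 4 → (∀ z, inS τ z → inS τ (z + q)) →
      ∀ z, inS τ' (permAct π (z + q)) → inS τ' (permAct π z) := by
    intro q hw hk z hz
    have := K q hw hk _ hz
    rwa [← permAct_add, add_cancel] at this
  intro z
  induction hn : hammingNorm z using Nat.strong_induction_on generalizing z with
  | _ n ih =>
  intro hz
  subst hn
  by_cases hl : 2 < hammingNorm (z ∘ Sum.inl)
  · obtain ⟨h, p1, p2, p3, p4⟩ := reduce _ hl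
    have hk : ∀ z, inS τ z → inS τ (z + Sum.elim h 0) := by
      rintro z ⟨z1, z2, z3⟩
      have c1 : (z + Sum.elim h 0) ∘ Sum.inl = z ∘ Sum.inl + h := rfl
      have c2 : (z + Sum.elim h 0) ∘ Sum.inr = z ∘ Sum.inr + 0 := rfl
      simp only [inS, c1, c2, par_add, syn_add, p1, p2, par_zero, syn_zero, add_zero]
      exact ⟨z1, z2, z3⟩
    refine step _ ?_ hk z (ih _ ?_ _ rfl (hk _ hz))
    · rw [norm_split, Sum.elim_comp_inl, Sum.elim_comp_inr, p3, hammingNorm_zero]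
    · rw [norm_split, norm_split z]
      have c1 : (z + Sum.elim h 0) ∘ Sum.inl = z ∘ Sum.inl + h := rfl
      have c2 : (z + Sum.elim h 0) ∘ Sum.inr = z ∘ Sum.inr + 0 := rfl
      rw [c1, c2, add_zero]
      omega
  by_cases hr : 2 < hammingNorm (z ∘ Sum.inr)
  · obtain ⟨h, p1, p2, p3, p4⟩ := reduce _ hr
    have hk : ∀ z, inS τ z → inS τ (z + Sum.elim (0 : V r → ZMod 2) h) := by
      rintro z ⟨z1, z2, z3⟩
      have c1 : (z + Sum.elim (0 : V r → ZMod 2) h) ∘ Sum.inl = z ∘ Sum.inl + 0 := rfl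
      have c2 : (z + Sum.elim (0 : V r → ZMod 2) h) ∘ Sum.inr = z ∘ Sum.inr + h := rfl
      simp only [inS, c1, c2, par_add, syn_add, p1, p2, par_zero, syn_zero, add_zero]
      exact ⟨z1, z2, z3⟩
    refine step _ ?_ hk z (ih _ ?_ _ rfl (hk _ hz))
    · rw [norm_split, Sum.elim_comp_inl, Sum.elim_comp_inr, p3, hammingNorm_zero]
    · rw [norm_split, norm_split z]
      have c1 : (z + Sum.elim (0 : V r → ZMod 2) h) ∘ Sum.inl = z ∘ Sum.inl + 0 := rfl
      have c2 : (z + Sum.elim (0 : V r → ZMod 2) h) ∘ Sum.inr = z ∘ Sum.inr + h := rfl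
      rw [c1, c2, add_zero]
      omega
  by_cases h4 : hammingNorm z = 4
  · exact (H z h4).1 hz
  have hz' := hz
  obtain ⟨z1, z2, z3⟩ := hz
  have hs := norm_split z
  obtain ⟨m, hm⟩ := norm_even z1
  obtain ⟨n, hn⟩ := norm_even z2
  have nt : ∀ x : V r → ZMod 2, hammingNorm x = 2 → syn x ≠ 0 := by
    intro x hx hs
    obtain ⟨a, b, hab, rfl⟩ := norm_two hx
    rw [syn_add, syn_unit, syn_unit] at hs
    exact hab ((eq_iff _ _).2 hs)
  by_cases hL : hammingNorm (z ∘ Sum.inl) = 0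
  · by_cases hR : hammingNorm (z ∘ Sum.inr) = 0
    · have : z = 0 := by rw [← hammingNorm_eq_zero, hs, hL, hR]
      rw [this]
      exact zeroS τ' h0'
    · exfalso
      rw [hammingNorm_eq_zero] at hL
      rw [hL, syn_zero, h0] at z3
      exact nt _ (by omega) z3.symm
  · exfalso
    have hR : hammingNorm (z ∘ Sum.inr) = 0 := by omega
    rw [hammingNorm_eq_zero] at hR
    rw [hR, syn_zero, ← h0, τ.apply_eq_iff_eq] at z3
    exact nt _ (by omega) z3

lemma main {r : ℕ} (τ τ' : Equiv.Perm (V r))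
    (h0 : τ 0 = 0) (h0' : τ' 0 = 0) (π : Equiv.Perm (Pt r)) :
    qAct π (SQS τ) = SQS τ' ↔ permAct π '' Scode τ = Scode τ' := by
  constructor
  · intro h
    have H : ∀ z, hammingNorm z = 4 → (inS τ z ↔ inS τ' (permAct π z)) := by
      intro z hz
      obtain ⟨q, rfl⟩ := ind_surj z
      rw [ind_norm] at hz
      have hz' : (q.image π).card = 4 := by
        rw [Finset.card_image_of_injective _ π.injective, hz]
      have a1 := mem_SQS τ h0 q
      have a2 := mem_SQS τ' h0' (q.image π)
      rw [permAct_ind]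
      have : q ∈ SQS τ ↔ q.image π ∈ SQS τ' := by
        rw [← h]
        exact ((Finset.image_injective π.injective).mem_set_image).symm
      tauto
    have H' : ∀ z, hammingNorm z = 4 → (inS τ' z ↔ inS τ (permAct π.symm z)) := by
      intro z hz
      rw [H _ (by rw [permAct_norm, hz]), permAct_symm]
    ext z
    rw [mem_S]
    constructor
    · rintro ⟨y, hy, rfl⟩
      exact transfer τ τ' h0 h0' π H y ((mem_S _ _).1 hy)
    · intro hz
      exact ⟨_, (mem_S _ _).2 (transfer τ' τ h0' h0 π.symm H' z hz), permAct_symm π z⟩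
  · intro h
    have H : ∀ q : Finset (Pt r), q ∈ SQS τ ↔ q.image π ∈ SQS τ' := by
      intro q
      rw [mem_SQS τ h0, mem_SQS τ' h0', Finset.card_image_of_injective _ π.injective,
        ← permAct_ind, ← mem_S, ← mem_S, ← h]
      have inj : Function.Injective (permAct π) :=
        Function.LeftInverse.injective (permAct_symm' π)
      rw [inj.mem_set_image]
    ext q
    constructor
    · rintro ⟨p, hp, rfl⟩
      exact (H p).1 hp
    · intro hq
      have e : (q.image π.symm).image π = q := by
        rw [Finset.image_image]; simp
      exact ⟨q.image π.symm, (H _).2 (by rwa [e]), e⟩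

end SQSProof

/-- a coordinate permutation `π` maps `SQS_τ` onto `SQS_{τ'}` iff it
maps the code `S_τ` onto the code `S_{τ'}`. -/
theorem SQS_iso_iff_Scode_iso {r : ℕ} (τ τ' : Equiv.Perm (V r))
    (h0 : τ 0 = 0) (h0' : τ' 0 = 0) (π : Equiv.Perm (Pt r)) :
    qAct π (SQS τ) = SQS τ' ↔ permAct π '' Scode τ = Scode τ' := by
  exact SQSProof.main τ τ' h0 h0' π
end

section
/- Let τ be a permutation of the vectors of F^r fixing 0. Then the permutation automorphism group PAut(S_τ) of the code S_τ coincides with the automorphism group Aut(SQS_τ) of its Steiner quadruple system (as permutation groups on the 2^{r+1} coordinate positions); in particular, these groups are isomorphic. -/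
open Finset

section aux

variable {r : ℕ}

theorem char2V (x : V r) : x + x = 0 := by
  funext i
  exact CharTwo.add_self_eq_zero (x i)

theorem eq_of_add_zero {x y : V r} (h : x + y = 0) : x = y := by
  have h1 := char2V y
  calc x = x + y + y := by rw [add_assoc, h1, add_zero]
    _ = y := by rw [h, zero_add]

theorem sum_symmDiff2 {α M : Type} [DecidableEq α] [AddCommGroup M] (hM : ∀ x : M, x + x = 0)
    (f : α → M) (A B : Finset α) :
    ∑ x ∈ symmDiff A B, f x = ∑ x ∈ A, f x + ∑ x ∈ B, f x := by
  have hd : symmDiff A B = (A \ B) ∪ (B \ A) := rfl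
  rw [hd, Finset.sum_union (disjoint_sdiff_sdiff)]
  have h1 := Finset.sum_inter_add_sum_sdiff A B f
  have h2 := Finset.sum_inter_add_sum_sdiff B A f
  rw [Finset.inter_comm] at h2
  rw [← h1, ← h2]
  have := hM (∑ x ∈ A ∩ B, f x)
  calc _ = (∑ x ∈ A ∩ B, f x + ∑ x ∈ A ∩ B, f x) + (∑ x ∈ A \ B, f x + ∑ x ∈ B \ A, f x) := by
        rw [this, zero_add]
    _ = _ := by abel

def sL (t : Finset (Pt r)) : V r := ∑ p ∈ t, Sum.elim (fun a => a) (fun _ => 0) p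
def sR (t : Finset (Pt r)) : V r := ∑ p ∈ t, Sum.elim (fun _ => 0) (fun a => a) p
def nL (t : Finset (Pt r)) : ZMod 2 := ∑ p ∈ t, Sum.elim (fun _ => 1) (fun _ => 0) p
def nR (t : Finset (Pt r)) : ZMod 2 := ∑ p ∈ t, Sum.elim (fun _ => 0) (fun _ => 1) p

theorem sL_sd (s t : Finset (Pt r)) : sL (symmDiff s t) = sL s + sL t :=
  sum_symmDiff2 char2V _ _ _
theorem sR_sd (s t : Finset (Pt r)) : sR (symmDiff s t) = sR s + sR t :=
  sum_symmDiff2 char2V _ _ _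
theorem nL_sd (s t : Finset (Pt r)) : nL (symmDiff s t) = nL s + nL t :=
  sum_symmDiff2 CharTwo.add_self_eq_zero _ _ _
theorem nR_sd (s t : Finset (Pt r)) : nR (symmDiff s t) = nR s + nR t :=
  sum_symmDiff2 CharTwo.add_self_eq_zero _ _ _

theorem sum_split {M : Type} [AddCommMonoid M] (f : Pt r → M) (t : Finset (Pt r)) :
    ∑ p ∈ t, f p = ∑ a ∈ t.toLeft, f (Sum.inl a) + ∑ a ∈ t.toRight, f (Sum.inr a) := by
  conv_lhs => rw [← Finset.toLeft_disjSum_toRight (u := t)]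
  rw [Finset.sum_disjSum]

theorem sL_eq (t : Finset (Pt r)) : sL t = ∑ a ∈ t.toLeft, a := by simp [sL, sum_split]
theorem sR_eq (t : Finset (Pt r)) : sR t = ∑ a ∈ t.toRight, a := by simp [sR, sum_split]
theorem nL_eq (t : Finset (Pt r)) : nL t = (t.toLeft.card : ZMod 2) := by simp [nL, sum_split]
theorem nR_eq (t : Finset (Pt r)) : nR t = (t.toRight.card : ZMod 2) := by simp [nR, sum_split]

def TT (τ : Equiv.Perm (V r)) (t : Finset (Pt r)) : Prop :=
  nL t = 0 ∧ nR t = 0 ∧ τ (sL t) = sR t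

def ind (t : Finset (Pt r)) : Pt r → ZMod 2 := fun p => if p ∈ t then 1 else 0

theorem mem_Scode_iff (τ : Equiv.Perm (V r)) (z : Pt r → ZMod 2) :
    z ∈ Scode τ ↔ ∑ a, z (Sum.inl a) = 0 ∧ ∑ a, z (Sum.inr a) = 0 ∧
      τ (∑ a, z (Sum.inl a) • a) = ∑ a, z (Sum.inr a) • a := by
  have hu : ∀ a : V r, ∑ b, unitVec a b = 1 := by intro a; simp [unitVec]
  have hv : ∀ a : V r, ∑ b, unitVec a b • b = a := by intro a; simp [unitVec]
  have h2 : (1 : ZMod 2) + 1 = 0 := rfl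
  constructor
  · intro hz
    simp only [Scode, Set.mem_iUnion, Set.mem_setOf_eq] at hz
    obtain ⟨a, h₁, ⟨hs1, hn1⟩, h₂, ⟨hs2, hn2⟩, rfl⟩ := hz
    simp [Finset.sum_add_distrib, add_smul, hu, hv, hs1, hs2, hn1, hn2, h2]
  · rintro ⟨hl, hr, hτ⟩
    simp only [Scode, Set.mem_iUnion, Set.mem_setOf_eq]
    refine ⟨∑ a, z (Sum.inl a) • a,
      (fun b => z (Sum.inl b)) + unitVec (∑ a, z (Sum.inl a) • a) + unitVec 0, ?_,
      (fun b => z (Sum.inr b)) + unitVec (τ (∑ a, z (Sum.inl a) • a)) + unitVec 0, ?_, ?_⟩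
    · constructor <;> simp [Finset.sum_add_distrib, add_smul, hu, hv, hl, h2, char2V]
    · constructor <;> simp [Finset.sum_add_distrib, add_smul, hu, hv, hr, h2, hτ, char2V]
    · have hc : ∀ x y w : ZMod 2, x + y + w + y + w = x := by decide
      funext p
      rcases p with p | p <;> simp [hc]

theorem ind_mem (τ : Equiv.Perm (V r)) (t : Finset (Pt r)) : ind t ∈ Scode τ ↔ TT τ t := by
  rw [mem_Scode_iff, TT, sL_eq, sR_eq, nL_eq, nR_eq]
  have h1 : ∀ a, Sum.inl a ∈ t ↔ a ∈ t.toLeft := by simp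
  have h2 : ∀ a, Sum.inr a ∈ t ↔ a ∈ t.toRight := by simp
  simp only [ind, h1, h2, ite_smul, one_smul, zero_smul, Finset.sum_ite_mem, Finset.univ_inter,
    Finset.sum_const, nsmul_eq_mul, mul_one]

theorem exists_ind (z : Pt r → ZMod 2) : ∃ t, z = ind t := by
  classical
  refine ⟨Finset.univ.filter (fun p => z p = 1), ?_⟩
  funext p
  have : ∀ x : ZMod 2, x = if x = 1 then 1 else 0 := by decide
  simpa [ind] using this (z p)

theorem permAct_ind (π : Equiv.Perm (Pt r)) (t : Finset (Pt r)) :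
    permAct π (ind t) = ind (t.image π) := by
  funext p
  have : p ∈ t.image π ↔ π.symm p ∈ t := by
    simp only [Finset.mem_image]
    constructor
    · rintro ⟨a, ha, rfl⟩; simpa
    · intro h; exact ⟨_, h, by simp⟩
  simp only [permAct, ind, this]

theorem image_symm_image (π : Equiv.Perm (Pt r)) (t : Finset (Pt r)) :
    (t.image π.symm).image π = t := by
  simp [Finset.image_image]

theorem image_image_symm (π : Equiv.Perm (Pt r)) (t : Finset (Pt r)) :
    (t.image π).image π.symm = t := by
  simp [Finset.image_image]

theorem quad_mem (τ : Equiv.Perm (V r)) (h0 : τ 0 = 0) (q : Finset (Pt r)) :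
    q ∈ SQS τ ↔ TT τ q ∧ q.card = 4 := by
  have h4 : (4 : ZMod 2) = 0 := rfl
  have h2 : (2 : ZMod 2) = 0 := rfl
  constructor
  · rintro ((⟨a, b, c, d, hab, hac, had, hbc, hbd, hcd, hs, rfl⟩ |
      ⟨a, b, c, d, hab, hac, had, hbc, hbd, hcd, hs, rfl⟩) | ⟨a, b, c, d, hs, hne, rfl⟩)
    · constructor
      · simp [TT, sL, sR, nL, nR, *, ← add_assoc]; rfl
      · simp [*]
    · constructor
      · simp [TT, sL, sR, nL, nR, *, ← add_assoc]; rfl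
      · simp [*]
    · have hac : a ≠ c := by rintro rfl; rw [char2V, h0] at hs; exact hne hs.symm
      have hbd : b ≠ d := by rintro rfl; exact hne (char2V b)
      constructor
      · simp [TT, sL, sR, nL, nR, *]; rfl
      · simp [*]
  · rintro ⟨⟨hl, hr, hτ⟩, hc⟩
    rw [nL_eq, ZMod.natCast_eq_zero_iff_even] at hl
    rw [nR_eq, ZMod.natCast_eq_zero_iff_even] at hr
    rw [sL_eq, sR_eq] at hτ
    rw [← Finset.card_toLeft_add_card_toRight] at hc
    have hq := (Finset.toLeft_disjSum_toRight (u := q)).symm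
    generalize q.toLeft = A at *
    generalize q.toRight = B at *
    subst hq
    have hA : A.card = 0 ∨ A.card = 2 ∨ A.card = 4 := by
      obtain ⟨x, hx⟩ := hl; omega
    rcases hA with hA | hA | hA
    · rw [hA, zero_add] at hc
      obtain ⟨a, b, c, d, h1, h2, h3, h4, h5, h6, rfl⟩ := Finset.card_eq_four.1 hc
      rw [Finset.card_eq_zero] at hA
      subst hA
      refine Or.inl (Or.inr ⟨a, b, c, d, h1, h2, h3, h4, h5, h6, ?_, ?_⟩)
      · simp [h0, *, ← add_assoc] at hτ
        exact hτ.symm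
      · ext x; rcases x with x | x <;> simp
    · have hB : B.card = 2 := by omega
      obtain ⟨a, c, hac, rfl⟩ := Finset.card_eq_two.1 hA
      obtain ⟨b, d, hbd, rfl⟩ := Finset.card_eq_two.1 hB
      refine Or.inr ⟨a, b, c, d, ?_, fun h => hbd (eq_of_add_zero h), ?_⟩
      · simpa [hac, hbd] using hτ
      · ext x; rcases x with x | x <;> simp
    · have hB : B.card = 0 := by omega
      obtain ⟨a, b, c, d, h1, h2, h3, h4, h5, h6, rfl⟩ := Finset.card_eq_four.1 hA
      rw [Finset.card_eq_zero] at hB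
      subst hB
      refine Or.inl (Or.inl ⟨a, b, c, d, h1, h2, h3, h4, h5, h6, ?_, ?_⟩)
      · simp [*, ← add_assoc] at hτ
        exact τ.injective (hτ.trans h0.symm)
      · ext x; rcases x with x | x <;> simp

/-- Quadruples which can be added to intersecting quadruples. -/
def Kq (τ : Equiv.Perm (V r)) (q : Finset (Pt r)) : Prop :=
  q ∈ SQS τ ∧ ∀ q' ∈ SQS τ, (symmDiff q q').card = 4 → symmDiff q q' ∈ SQS τ

theorem TT_sd {τ : Equiv.Perm (V r)} {s t : Finset (Pt r)} (hs : TT τ s) (ht : TT τ t)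
    (h : τ (sL s + sL t) = τ (sL s) + τ (sL t)) : TT τ (symmDiff s t) := by
  obtain ⟨a, b, c⟩ := hs
  obtain ⟨a', b', c'⟩ := ht
  refine ⟨?_, ?_, ?_⟩
  · rw [nL_sd, a, a', add_zero]
  · rw [nR_sd, b, b', add_zero]
  · rw [sL_sd, sR_sd, h, c, c']

theorem Kq_of_zero {τ : Equiv.Perm (V r)} (h0 : τ 0 = 0) {q : Finset (Pt r)} (hq : q ∈ SQS τ)
    (hs : sL q = 0) : Kq τ q := by
  refine ⟨hq, fun q' hq' hc => ?_⟩
  rw [quad_mem τ h0] at hq hq' ⊢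
  exact ⟨TT_sd hq.1 hq'.1 (by simp [hs, h0]), hc⟩

theorem Kq_add {τ : Equiv.Perm (V r)} (h0 : τ 0 = 0) {q : Finset (Pt r)} (hq : Kq τ q)
    {t : Finset (Pt r)} (ht : TT τ t) : TT τ (symmDiff t q) := by
  have hqT := ((quad_mem τ h0 q).1 hq.1).1
  refine TT_sd ht hqT ?_
  generalize sL t = u
  by_cases hs : sL q = 0
  · simp [hs, h0]
  by_cases hu : u = 0
  · simp [hu, h0]
  by_cases hus : u = sL q
  · rw [hus, char2V, char2V, h0]
  obtain ⟨hqS, hqK⟩ := hq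
  have hqS' := hqS
  rcases hqS' with (⟨a, b, c, d, hab, hac, had, hbc, hbd, hcd, hz, rfl⟩ |
      ⟨a, b, c, d, hab, hac, had, hbc, hbd, hcd, hz, rfl⟩) | ⟨a, b, c, d, hz, hne, rfl⟩
  · exfalso; apply hs; simp [sL, *, ← add_assoc]
  · exfalso; apply hs; simp [sL, *]
  · have hac : a ≠ c := by rintro rfl; rw [char2V, h0] at hz; exact hne hz.symm
    have hbd : b ≠ d := by rintro rfl; exact hne (char2V b)
    have hsL : sL ({Sum.inl a, Sum.inl c, Sum.inr b, Sum.inr d} : Finset (Pt r)) = a + c := by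
      simp [sL, hac, hbd]
    have hsR : sR ({Sum.inl a, Sum.inl c, Sum.inr b, Sum.inr d} : Finset (Pt r)) = b + d := by
      rw [← hqT.2.2, hsL, hz]
    rw [hsL] at hs hus ⊢
    have hτu : τ u ≠ 0 := fun h => hu (τ.injective (h.trans h0.symm))
    have haa : ∀ x y : V r, x + (x + y) = y := fun x y => by
      rw [← add_assoc, char2V, zero_add]
    have hcu : c ≠ a + u := by rintro rfl; exact hus (haa a u).symm
    have hdu : d ≠ b + τ u := by
      rintro rfl; rw [haa] at hz; exact hus (τ.injective hz).symm
    have hau : a ≠ a + u := by simpa using hu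
    have hbu : b ≠ b + τ u := by simpa using hτu
    have hq' : ({Sum.inl a, Sum.inl (a + u), Sum.inr b, Sum.inr (b + τ u)} : Finset (Pt r))
        ∈ SQS τ := Or.inr ⟨a, b, a + u, b + τ u, by rw [haa, haa], by rwa [haa], rfl⟩
    have key := hqK _ hq' ?_
    · have := ((quad_mem τ h0 _).1 key).1.2.2
      rw [sL_sd, sR_sd, hsL, hsR] at this
      simp [sL, sR, hau, hbu, hbd, haa] at this
      rw [add_comm u, this, hz, add_comm]
    · have : symmDiff ({Sum.inl a, Sum.inl c, Sum.inr b, Sum.inr d} : Finset (Pt r))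
          {Sum.inl a, Sum.inl (a + u), Sum.inr b, Sum.inr (b + τ u)}
          = {Sum.inl c, Sum.inl (a + u), Sum.inr d, Sum.inr (b + τ u)} := by
        ext x
        rcases x with x | x <;> simp only [Finset.mem_symmDiff, Finset.mem_insert,
          Finset.mem_singleton, Sum.inl.injEq, Sum.inr.injEq, reduceCtorEq] <;> grind
      rw [this]
      simp [hcu, hdu]

theorem Kq_image {τ : Equiv.Perm (V r)} {π : Equiv.Perm (Pt r)}
    (hπ : ∀ q, q ∈ SQS τ ↔ q.image π ∈ SQS τ) {q : Finset (Pt r)} (hq : Kq τ q) :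
    Kq τ (q.image π) := by
  refine ⟨(hπ _).1 hq.1, fun q' hq' hc => ?_⟩
  rw [← image_symm_image π q'] at hq' hc ⊢
  rw [← Finset.image_symmDiff _ _ π.injective] at hc ⊢
  rw [Finset.card_image_of_injective _ π.injective] at hc
  exact (hπ _).1 (hq.2 _ ((hπ _).2 hq') hc)

theorem card_sd_lt (t : Finset (Pt r)) (x y z w : Pt r) (hx : x ∈ t) (hy : y ∈ t) (hz : z ∈ t)
    (hxy : x ≠ y) (hxz : x ≠ z) (hyz : y ≠ z) :
    (symmDiff t {x, y, z, w}).card < t.card := by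
  have h1 : symmDiff t {x, y, z, w} ⊆ insert w (t \ {x, y, z}) := by
    intro p
    simp only [Finset.mem_symmDiff, Finset.mem_insert, Finset.mem_singleton, Finset.mem_sdiff]
    grind
  have h2 : ({x, y, z} : Finset (Pt r)) ⊆ t := by
    intro p; simp only [Finset.mem_insert, Finset.mem_singleton]; grind
  have h3 : ({x, y, z} : Finset (Pt r)).card = 3 := Finset.card_eq_three.2
    ⟨x, y, z, hxy, hxz, hyz, rfl⟩
  have h4 := Finset.card_le_card h1
  have h5 := Finset.card_insert_le w (t \ {x, y, z})
  have h6 := Finset.card_sdiff_add_card_eq_card h2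
  omega

theorem descent {τ : Equiv.Perm (V r)} (h0 : τ 0 = 0) {t : Finset (Pt r)} (ht : TT τ t) :
    t = ∅ ∨ t ∈ SQS τ ∨ ∃ k, Kq τ k ∧ (symmDiff t k).card < t.card := by
  have h4 : ∀ a b c : V r, a + b + c + (a + b + c) = 0 := fun a b c => char2V _
  have hne1 : ∀ a b c : V r, b ≠ c → a ≠ a + b + c := by
    intro a b c h h'
    rw [add_assoc] at h'
    exact h (eq_of_add_zero (by simpa using h'))
  by_cases hl : 2 < t.toLeft.card
  · obtain ⟨a, ha, b, hb, c, hc, hab, hac, hbc⟩ := Finset.two_lt_card.1 hl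
    right; right
    have had := hne1 a b c hbc
    have hbd : b ≠ a + b + c := by rw [add_comm a b]; exact hne1 b a c hac
    have hcd : c ≠ a + b + c := by
      rw [add_comm]; simpa [add_assoc] using hne1 c a b hab
    refine ⟨{Sum.inl a, Sum.inl b, Sum.inl c, Sum.inl (a + b + c)}, Kq_of_zero h0
      (Or.inl (Or.inl ⟨a, b, c, _, hab, hac, had, hbc, hbd, hcd, h4 a b c, rfl⟩)) ?_, ?_⟩
    · simp only [sL]
      rw [Finset.sum_insert, Finset.sum_insert, Finset.sum_insert, Finset.sum_singleton]
      · simpa [← add_assoc] using h4 a b c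
      all_goals simp only [Finset.mem_insert, Finset.mem_singleton, Sum.inl.injEq]; tauto
    · apply card_sd_lt <;> simp_all
  by_cases hr : 2 < t.toRight.card
  · obtain ⟨a, ha, b, hb, c, hc, hab, hac, hbc⟩ := Finset.two_lt_card.1 hr
    right; right
    have had := hne1 a b c hbc
    have hbd : b ≠ a + b + c := by rw [add_comm a b]; exact hne1 b a c hac
    have hcd : c ≠ a + b + c := by
      rw [add_comm]; simpa [add_assoc] using hne1 c a b hab
    refine ⟨{Sum.inr a, Sum.inr b, Sum.inr c, Sum.inr (a + b + c)}, Kq_of_zero h0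
      (Or.inl (Or.inr ⟨a, b, c, _, hab, hac, had, hbc, hbd, hcd, h4 a b c, rfl⟩)) ?_, ?_⟩
    · rw [sL]
      refine Finset.sum_eq_zero fun x hx => ?_
      simp only [Finset.mem_insert, Finset.mem_singleton] at hx
      rcases hx with rfl | rfl | rfl | rfl <;> rfl
    · apply card_sd_lt <;> simp_all
  have ht' := ht
  obtain ⟨hl', hr', hτ⟩ := ht'
  rw [nL_eq, ZMod.natCast_eq_zero_iff_even] at hl'
  rw [nR_eq, ZMod.natCast_eq_zero_iff_even] at hr'
  rw [sL_eq, sR_eq] at hτ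
  have hc := Finset.card_toLeft_add_card_toRight (u := t)
  have hA : t.toLeft.card = 0 ∨ t.toLeft.card = 2 := by obtain ⟨x, hx⟩ := hl'; omega
  have hB : t.toRight.card = 0 ∨ t.toRight.card = 2 := by obtain ⟨x, hx⟩ := hr'; omega
  rcases hA with hA | hA <;> rcases hB with hB | hB
  · left; rw [← Finset.card_eq_zero]; omega
  · obtain ⟨a, b, hab, h⟩ := Finset.card_eq_two.1 hB
    rw [Finset.card_eq_zero] at hA
    rw [hA, h, Finset.sum_empty, h0, Finset.sum_pair hab] at hτ
    exact absurd (eq_of_add_zero hτ.symm) hab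
  · obtain ⟨a, b, hab, h⟩ := Finset.card_eq_two.1 hA
    rw [Finset.card_eq_zero] at hB
    rw [hB, h, Finset.sum_empty, Finset.sum_pair hab] at hτ
    exact absurd (eq_of_add_zero (τ.injective (hτ.trans h0.symm))) hab
  · right; left
    rw [quad_mem τ h0]
    exact ⟨ht, by omega⟩

theorem TT_image {τ : Equiv.Perm (V r)} (h0 : τ 0 = 0) {π : Equiv.Perm (Pt r)}
    (hπ : ∀ q, q ∈ SQS τ ↔ q.image π ∈ SQS τ) :
    ∀ (n : ℕ) (t : Finset (Pt r)), t.card = n → TT τ t → TT τ (t.image π) := by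
  intro n
  induction n using Nat.strong_induction_on with
  | _ n ih =>
    intro t hn ht
    rcases descent h0 ht with rfl | h | ⟨k, hk, hlt⟩
    · simpa using ht
    · exact ((quad_mem τ h0 _).1 ((hπ _).1 h)).1
    · have h1 := ih _ (hn ▸ hlt) _ rfl (Kq_add h0 hk ht)
      have h2 := Kq_add h0 (Kq_image hπ hk) h1
      rw [← Finset.image_symmDiff _ _ π.injective, symmDiff_symmDiff_cancel_right] at h2
      exact h2

theorem code_iff (τ : Equiv.Perm (V r)) (π : Equiv.Perm (Pt r)) :
    permAct π '' Scode τ = Scode τ ↔ ∀ t, TT τ t ↔ TT τ (t.image π) := by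
  constructor
  · intro h t
    rw [← ind_mem, ← ind_mem, ← permAct_ind]
    constructor
    · intro ht; rw [← h]; exact ⟨_, ht, rfl⟩
    · intro ht
      rw [← h] at ht
      obtain ⟨z, hz, he⟩ := ht
      have : z = ind t := by
        funext p
        have := congrFun he (π p)
        simpa [permAct] using this
      rwa [← this]
  · intro h
    ext z
    obtain ⟨t, rfl⟩ := exists_ind z
    constructor
    · rintro ⟨w, hw, he⟩
      obtain ⟨s, rfl⟩ := exists_ind w
      rw [← he, permAct_ind, ind_mem, ← h, ← ind_mem]
      exact hw
    · intro ht
      refine ⟨ind (t.image π.symm), ?_, ?_⟩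
      · rwa [ind_mem, h, image_symm_image, ← ind_mem]
      · rw [permAct_ind, image_symm_image]

theorem quad_iff (Q : Set (Finset (Pt r))) (π : Equiv.Perm (Pt r)) :
    qAct π Q = Q ↔ ∀ q, q ∈ Q ↔ q.image π ∈ Q := by
  constructor
  · intro h q
    constructor
    · intro hq; rw [← h]; exact ⟨q, hq, rfl⟩
    · intro hq
      rw [← h] at hq
      obtain ⟨q', hq', he⟩ := hq
      rwa [← Finset.image_injective π.injective he]
  · intro h
    ext q
    constructor
    · rintro ⟨q', hq', rfl⟩; exact (h _).1 hq'
    · intro hq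
      exact ⟨q.image π.symm, by rwa [h, image_symm_image], image_symm_image π q⟩

end aux

/-- `PAut(S_τ) = Aut(SQS_τ)` as permutation groups on the `2^{r+1}`
coordinate positions (in particular they are isomorphic). -/
theorem PAut_Scode_eq_Aut_SQS {r : ℕ} (τ : Equiv.Perm (V r)) (h0 : τ 0 = 0) :
    {π : Equiv.Perm (Pt r) | permAct π '' Scode τ = Scode τ}
      = {π : Equiv.Perm (Pt r) | qAct π (SQS τ) = SQS τ} := by
  ext π
  simp only [Set.mem_setOf_eq]
  rw [code_iff, quad_iff]
  constructor
  · intro h q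
    rw [quad_mem τ h0, quad_mem τ h0, ← h, Finset.card_image_of_injective _ π.injective]
  · intro h t
    refine ⟨TT_image h0 h _ t rfl, fun ht => ?_⟩
    have h' : ∀ q, q ∈ SQS τ ↔ q.image π.symm ∈ SQS τ := by
      intro q
      rw [h (q.image π.symm), image_symm_image]
    have := TT_image h0 h' _ _ rfl ht
    rwa [image_image_symm] at this
end

section
/- Let τ and τ' be permutations of the vectors of F^r fixing 0, and suppose S_τ and S_{τ'} are transitive codes of length 2^{r+1}. Then there exist x ∈ F^{2^{r+1}} and a permutation π with x + π(S_τ) = S_{τ'} if and only if there exists a permutation π' mapping SQS_τ onto SQS_{τ'}. -/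
open Finset

theorem vadd_self {r : ℕ} (a : V r) : a + a = 0 := by
  ext i; exact CharTwo.add_self_eq_zero _

theorem vadd_cancel {r : ℕ} (a b : V r) : a + (a + b) = b := by
  rw [← add_assoc, vadd_self, zero_add]

theorem vadd_eq_zero {r : ℕ} {a b : V r} : a + b = 0 ↔ a = b := by
  constructor
  · intro h
    have := vadd_cancel a b
    rw [h, add_zero] at this
    exact this
  · rintro rfl; exact vadd_self a

theorem vadd_eq_iff {r : ℕ} {a b c : V r} : a + b = c ↔ b = a + c := by
  constructor
  · rintro rfl; rw [vadd_cancel]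
  · rintro rfl; rw [vadd_cancel]

theorem sum_unitVec {r : ℕ} (a : V r) : ∑ b, unitVec a b = 1 := by
  simp [unitVec]

theorem sum_unitVec_smul {r : ℕ} (a : V r) : ∑ b, unitVec a b • b = a := by
  simp [unitVec]

theorem mem_Scode {r : ℕ} (τ : Equiv.Perm (V r)) (z : Pt r → ZMod 2) :
    z ∈ Scode τ ↔ ∑ a, z (Sum.inl a) = 0 ∧ ∑ a, z (Sum.inr a) = 0 ∧
      τ (∑ a, z (Sum.inl a) • a) = ∑ a, z (Sum.inr a) • a := by
  have h11 : (1 : ZMod 2) + 1 = 0 := by decide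
  simp only [Scode, Set.mem_iUnion, Set.mem_ofPred_eq]
  constructor
  · rintro ⟨a, h₁, ⟨h1, h1'⟩, h₂, ⟨h2, h2'⟩, rfl⟩
    simp only [Sum.elim_inl, Sum.elim_inr, Pi.add_apply, add_smul, Finset.sum_add_distrib,
      sum_unitVec, sum_unitVec_smul, h1, h1', h2, h2']
    simp [h11]
  · rintro ⟨h1, h2, h3⟩
    refine ⟨∑ a, z (Sum.inl a) • a,
      (fun a => z (Sum.inl a)) + unitVec (∑ a, z (Sum.inl a) • a) + unitVec 0, ⟨?_, ?_⟩,
      (fun a => z (Sum.inr a)) + unitVec (∑ a, z (Sum.inr a) • a) + unitVec 0, ⟨?_, ?_⟩, ?_⟩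
    · simp only [Pi.add_apply, add_smul, Finset.sum_add_distrib, sum_unitVec_smul, vadd_self,
        add_zero]
    · simp only [Pi.add_apply, Finset.sum_add_distrib, sum_unitVec, h1, zero_add, h11]
    · simp only [Pi.add_apply, add_smul, Finset.sum_add_distrib, sum_unitVec_smul, vadd_self,
        add_zero]
    · simp only [Pi.add_apply, Finset.sum_add_distrib, sum_unitVec, h2, zero_add, h11]
    · rw [h3]
      have h2x : ∀ x y w : ZMod 2, x = x + y + w + y + w := by decide
      funext p
      rcases p with a | a <;> simp only [Sum.elim_inl, Sum.elim_inr, Pi.add_apply] <;> exact h2x _ _ _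

/-- indicator word -/
def indW {r : ℕ} (q : Finset (Pt r)) : Pt r → ZMod 2 := fun p => if p ∈ q then 1 else 0

def fpL {r : ℕ} : Pt r → ZMod 2 := Sum.elim (fun _ => 1) (fun _ => 0)
def fpR {r : ℕ} : Pt r → ZMod 2 := Sum.elim (fun _ => 0) (fun _ => 1)
def fsL {r : ℕ} : Pt r → V r := Sum.elim id (fun _ => 0)
def fsR {r : ℕ} : Pt r → V r := Sum.elim (fun _ => 0) id

theorem indW_mem {r : ℕ} (τ : Equiv.Perm (V r)) (q : Finset (Pt r)) :
    indW q ∈ Scode τ ↔ ∑ p ∈ q, fpL p = 0 ∧ ∑ p ∈ q, fpR p = 0 ∧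
      τ (∑ p ∈ q, fsL p) = ∑ p ∈ q, fsR p := by
  have key : ∀ {M : Type} [AddCommGroup M] [Module (ZMod 2) M] (f : Pt r → M),
      ∑ p ∈ q, f p = ∑ a, indW q (Sum.inl a) • f (Sum.inl a)
        + ∑ a, indW q (Sum.inr a) • f (Sum.inr a) := by
    intro M _ _ f
    rw [← Fintype.sum_sum_type (fun p => indW q p • f p)]
    simp [indW, ite_smul]
  rw [mem_Scode, key, key, key, key]
  simp [fpL, fpR, fsL, fsR]

theorem indW_perm {r : ℕ} (π : Equiv.Perm (Pt r)) (q : Finset (Pt r)) :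
    permAct π (indW q) = indW (q.image π) := by
  funext p
  have : π.symm p ∈ q ↔ p ∈ q.image π := by
    simp only [Finset.mem_image]
    constructor
    · intro h; exact ⟨_, h, by simp⟩
    · rintro ⟨x, hx, rfl⟩; simpa using hx
  simp only [permAct, indW, this]

/-- the fourth point -/
def tp {r : ℕ} (τ : Equiv.Perm (V r)) : Pt r → Pt r → Pt r → Pt r
  | .inl a, .inl b, .inl c => .inl (a + b + c)
  | .inl a, .inl b, .inr c => .inr (c + τ (a + b))
  | .inl a, .inr b, .inl c => .inr (b + τ (a + c))
  | .inr a, .inl b, .inl c => .inr (a + τ (b + c))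
  | .inr a, .inr b, .inr c => .inr (a + b + c)
  | .inr a, .inr b, .inl c => .inl (c + τ.symm (a + b))
  | .inr a, .inl b, .inr c => .inl (b + τ.symm (a + c))
  | .inl a, .inr b, .inr c => .inl (a + τ.symm (b + c))

theorem card_four {r : ℕ} {x y z w : Pt r} (h : x ≠ y ∧ x ≠ z ∧ x ≠ w ∧ y ≠ z ∧ y ≠ w ∧ z ≠ w) :
    ({x, y, z, w} : Finset (Pt r)).card = 4 := by
  obtain ⟨h1, h2, h3, h4, h5, h6⟩ := h
  rw [Finset.card_insert_of_notMem, Finset.card_insert_of_notMem, Finset.card_insert_of_notMem,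
    Finset.card_singleton] <;> simp [*]

theorem of_card_four {r : ℕ} {x y z w : Pt r}
    (h : ({x, y, z, w} : Finset (Pt r)).card = 4) :
    x ≠ y ∧ x ≠ z ∧ x ≠ w ∧ y ≠ z ∧ y ≠ w ∧ z ≠ w := by
  have h3 : ∀ u v t : Pt r, ({u, v, t} : Finset (Pt r)).card ≤ 3 := fun u v t =>
    Finset.card_le_three
  have hh : ∀ u v t : Pt r, ({x, y, z, w} : Finset (Pt r)) = {u, v, t} → False := by
    intro u v t e
    have := h3 u v t
    rw [← e] at this
    omega
  refine ⟨?_, ?_, ?_, ?_, ?_, ?_⟩ <;> rintro rfl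
  · exact hh x z w (by ext p; simp)
  · exact hh x y w (by ext p; simp; tauto)
  · exact hh x y z (by ext p; simp; tauto)
  · exact hh x y w (by ext p; simp)
  · exact hh x y z (by ext p; simp; tauto)
  · exact hh x y z (by ext p; simp)

theorem sum_four {r : ℕ} {M : Type} [AddCommMonoid M] (f : Pt r → M) {x y z w : Pt r}
    (h : x ≠ y ∧ x ≠ z ∧ x ≠ w ∧ y ≠ z ∧ y ≠ w ∧ z ≠ w) :
    ∑ p ∈ ({x, y, z, w} : Finset (Pt r)), f p = f x + (f y + (f z + f w)) := by
  obtain ⟨h1, h2, h3, h4, h5, h6⟩ := h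
  rw [Finset.sum_insert, Finset.sum_insert, Finset.sum_insert, Finset.sum_singleton] <;> simp [*]

theorem SQS_card {r : ℕ} {τ : Equiv.Perm (V r)} (h0 : τ 0 = 0) {q : Finset (Pt r)}
    (hq : q ∈ SQS τ) : q.card = 4 := by
  rcases hq with (⟨a, b, c, d, h1, h2, h3, h4, h5, h6, h, rfl⟩ |
    ⟨a, b, c, d, h1, h2, h3, h4, h5, h6, h, rfl⟩) | ⟨a, b, c, d, h1, h2, rfl⟩
  · apply card_four; simp [*]
  · apply card_four; simp [*]
  · have hac : a ≠ c := by rintro rfl; rw [vadd_self, h0] at h1; exact h2 h1.symm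
    have hbd : b ≠ d := by rintro rfl; exact h2 (vadd_self b)
    apply card_four; simp [*]

theorem SQS_ind {r : ℕ} {τ : Equiv.Perm (V r)} (h0 : τ 0 = 0) {q : Finset (Pt r)}
    (hq : q ∈ SQS τ) : indW q ∈ Scode τ := by
  have h11 : (1 : ZMod 2) + 1 = 0 := by decide
  have h4 := SQS_card h0 hq
  rw [indW_mem]
  rcases hq with (⟨a, b, c, d, -, -, -, -, -, -, h, rfl⟩ |
    ⟨a, b, c, d, -, -, -, -, -, -, h, rfl⟩) | ⟨a, b, c, d, h1, h2, rfl⟩ <;>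
  simp only [sum_four _ (of_card_four h4), fpL, fpR, fsL, fsR, Sum.elim_inl, Sum.elim_inr, id,
    add_zero, zero_add, h11]
  · rw [← add_assoc, ← add_assoc, h]; simp [h0]
  · rw [← add_assoc, ← add_assoc, h]; simp [h0]
  · simp [h1]

theorem ind_tp {r : ℕ} {τ : Equiv.Perm (V r)} (h0 : τ 0 = 0) {x y z w : Pt r}
    (h : x ≠ y ∧ x ≠ z ∧ x ≠ w ∧ y ≠ z ∧ y ≠ w ∧ z ≠ w)
    (hq : indW {x, y, z, w} ∈ Scode τ) : w = tp τ x y z := by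
  have h11 : (1 : ZMod 2) + 1 = 0 := by decide
  have h0s : τ.symm 0 = 0 := by rw [Equiv.symm_apply_eq, h0]
  rw [indW_mem] at hq
  simp only [sum_four _ h] at hq
  rcases x with a | a <;> rcases y with b | b <;> rcases z with c | c <;> rcases w with d | d <;>
    simp only [fpL, fpR, fsL, fsR, Sum.elim_inl, Sum.elim_inr, id, tp,
      add_zero, zero_add, h11, one_ne_zero, false_and, and_false, true_and] at hq ⊢ <;>
    first
    | exact hq.elim
    | (congr 1
       first
       | (rw [h0] at hq; rw [← vadd_eq_zero, hq]; abel)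
       | (rw [hq]; simp only [vadd_cancel, vadd_self, add_comm, add_left_comm])
       | (rw [← hq]; simp only [Equiv.symm_apply_apply, vadd_cancel, vadd_self, add_comm, add_left_comm])
       | (rw [← Equiv.eq_symm_apply, h0s] at hq; rw [← vadd_eq_zero, ← hq]; abel))

theorem tp_mem {r : ℕ} {τ : Equiv.Perm (V r)} (h0 : τ 0 = 0) {x y z : Pt r}
    (h1 : x ≠ y) (h2 : x ≠ z) (h3 : y ≠ z) : {x, y, z, tp τ x y z} ∈ SQS τ := by
  have h0s : τ.symm 0 = 0 := by rw [Equiv.symm_apply_eq, h0]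
  have hne : ∀ a b : V r, a ≠ b → τ (a + b) ≠ 0 := by
    intro a b hab h
    rw [← Equiv.eq_symm_apply, h0s, vadd_eq_zero] at h
    exact hab h
  have hne' : ∀ a b : V r, a ≠ b → a + b ≠ 0 := fun a b hab h => hab (vadd_eq_zero.1 h)
  have hx : ∀ a b c : V r, b ≠ c → a ≠ a + b + c := by
    intro a b c hbc h
    apply hbc
    have := vadd_cancel a (b + c)
    rw [← add_assoc a b c, ← h, vadd_self] at this
    exact vadd_eq_zero.1 this.symm
  have hy : ∀ a b c : V r, a ≠ c → b ≠ a + b + c := by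
    intro a b c h; rw [add_comm a b]; exact hx _ _ _ h
  have hz : ∀ a b c : V r, a ≠ b → c ≠ a + b + c := by
    intro a b c h; rw [add_comm _ c, ← add_assoc]; exact hx _ _ _ h
  rcases x with a | a <;> rcases y with b | b <;> rcases z with c | c <;>
    simp only [ne_eq, Sum.inl.injEq, Sum.inr.injEq, reduceCtorEq, not_false_eq_true, tp] at h1 h2 h3 ⊢
  · exact Or.inl (Or.inl ⟨a, b, c, _, h1, h2, hx _ _ _ h3, h3, hy _ _ _ h2, hz _ _ _ h1,
      vadd_self _, rfl⟩)
  · refine Or.inr ⟨a, c, b, c + τ (a + b), by rw [vadd_cancel], ?_, rfl⟩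
    rw [vadd_cancel]; exact hne _ _ h1
  · refine Or.inr ⟨a, b, c, b + τ (a + c), by rw [vadd_cancel], ?_, ?_⟩
    · rw [vadd_cancel]; exact hne _ _ h2
    · ext p; simp; tauto
  · refine Or.inr ⟨a, b, a + τ.symm (b + c), c, by rw [vadd_cancel]; simp, hne' _ _ h3, ?_⟩
    ext p; simp; tauto
  · refine Or.inr ⟨b, a, c, a + τ (b + c), by rw [vadd_cancel], ?_, ?_⟩
    · rw [vadd_cancel]; exact hne _ _ h3
    · ext p; simp; tauto
  · refine Or.inr ⟨b, a, b + τ.symm (a + c), c, by rw [vadd_cancel]; simp, hne' _ _ h2, ?_⟩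
    ext p; simp; tauto
  · refine Or.inr ⟨c, a, c + τ.symm (a + b), b, by rw [vadd_cancel]; simp, hne' _ _ h1, ?_⟩
    ext p; simp; tauto
  · exact Or.inl (Or.inr ⟨a, b, c, _, h1, h2, hx _ _ _ h3, h3, hy _ _ _ h2, hz _ _ _ h1,
      vadd_self _, rfl⟩)

theorem mem_SQS_iff {r : ℕ} {τ : Equiv.Perm (V r)} (h0 : τ 0 = 0) {q : Finset (Pt r)} :
    q ∈ SQS τ ↔ q.card = 4 ∧ indW q ∈ Scode τ := by
  constructor
  · exact fun h => ⟨SQS_card h0 h, SQS_ind h0 h⟩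
  · rintro ⟨hc, hi⟩
    obtain ⟨x, y, z, w, h1, h2, h3, h4, h5, h6, rfl⟩ := Finset.card_eq_four.1 hc
    rw [ind_tp h0 ⟨h1, h2, h3, h4, h5, h6⟩ hi]
    exact tp_mem h0 h1 h2 h4

theorem SQS_of_Scode {r : ℕ} {τ τ' : Equiv.Perm (V r)} (h0 : τ 0 = 0) (h0' : τ' 0 = 0)
    (π : Equiv.Perm (Pt r)) (h : permAct π '' Scode τ = Scode τ') :
    qAct π (SQS τ) = SQS τ' := by
  have hc : ∀ q : Finset (Pt r), (q.image π).card = q.card := fun q =>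
    Finset.card_image_of_injective _ π.injective
  apply Set.Subset.antisymm
  · rintro _ ⟨q, hq, rfl⟩
    rw [mem_SQS_iff h0] at hq
    refine (mem_SQS_iff h0').2 ⟨(hc q).trans hq.1, ?_⟩
    rw [← indW_perm, ← h]
    exact ⟨_, hq.2, rfl⟩
  · intro q hq
    rw [mem_SQS_iff h0'] at hq
    have hq' : (q.image π.symm).image π = q := by
      rw [Finset.image_image]; simp
    refine ⟨q.image π.symm, ?_, hq'⟩
    rw [mem_SQS_iff h0, ← hc, hq']
    refine ⟨hq.1, ?_⟩
    have h2 := hq.2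
    rw [← h] at h2
    obtain ⟨u, hu, hu'⟩ := h2
    rw [← indW_perm, ← hu']
    have : permAct π.symm (permAct π u) = u := by funext p; simp [permAct]
    rwa [this]

theorem tp_left {r : ℕ} {τ : Equiv.Perm (V r)} (h0 : τ 0 = 0) (x z : Pt r) :
    tp τ x x z = z := by
  have h0s : τ.symm 0 = 0 := by rw [Equiv.symm_apply_eq, h0]
  rcases x with a | a <;> rcases z with c | c <;> simp [tp, vadd_self, h0, h0s]

theorem tp_mid {r : ℕ} {τ : Equiv.Perm (V r)} (h0 : τ 0 = 0) (x z : Pt r) :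
    tp τ x z x = z := by
  have h0s : τ.symm 0 = 0 := by rw [Equiv.symm_apply_eq, h0]
  have h : ∀ a c : V r, a + c + a = c := by
    intro a c; rw [add_comm, vadd_cancel]
  rcases x with a | a <;> rcases z with c | c <;> simp [tp, vadd_self, h0, h0s, h]

theorem tp_right {r : ℕ} {τ : Equiv.Perm (V r)} (h0 : τ 0 = 0) (x z : Pt r) :
    tp τ x z z = x := by
  have h0s : τ.symm 0 = 0 := by rw [Equiv.symm_apply_eq, h0]
  have h : ∀ a c : V r, a + c + c = a := by
    intro a c; rw [add_assoc, vadd_self, add_zero]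
  rcases x with a | a <;> rcases z with c | c <;> simp [tp, vadd_self, h0, h0s, h]

theorem tp_hom {r : ℕ} {τ τ' : Equiv.Perm (V r)} (h0 : τ 0 = 0) (h0' : τ' 0 = 0)
    (π : Equiv.Perm (Pt r)) (h : qAct π (SQS τ) = SQS τ') (x y z : Pt r) :
    π (tp τ x y z) = tp τ' (π x) (π y) (π z) := by
  by_cases h1 : x = y
  · subst h1; rw [tp_left h0, tp_left h0']
  by_cases h2 : x = z
  · subst h2; rw [tp_mid h0, tp_mid h0']
  by_cases h3 : y = z
  · subst h3; rw [tp_right h0, tp_right h0']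
  have hm : ({x, y, z, tp τ x y z} : Finset (Pt r)).image π ∈ SQS τ' := by
    rw [← h]; exact ⟨_, tp_mem h0 h1 h2 h3, rfl⟩
  simp only [Finset.image_insert, Finset.image_singleton] at hm
  exact ind_tp h0' (of_card_four (SQS_card h0' hm)) (SQS_ind h0' hm)

/-- the property distinguishing pairs inside one half -/
def Pp {r : ℕ} (τ : Equiv.Perm (V r)) (x y : Pt r) : Prop :=
  ∀ z w, tp τ z (tp τ x y z) w = tp τ x y w

theorem Pp_hom {r : ℕ} {τ τ' : Equiv.Perm (V r)} (π : Equiv.Perm (Pt r))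
    (h : ∀ x y z, π (tp τ x y z) = tp τ' (π x) (π y) (π z)) (x y : Pt r) :
    Pp τ x y ↔ Pp τ' (π x) (π y) := by
  constructor
  · intro hp z w
    have := congrArg π (hp (π.symm z) (π.symm w))
    simpa [h] using this
  · intro hp z w
    apply π.injective
    simpa [h] using hp (π z) (π w)

theorem Pp_same {r : ℕ} {τ : Equiv.Perm (V r)} {x y : Pt r} (hxy : x.isLeft = y.isLeft) :
    Pp τ x y := by
  have h1 : ∀ a b c : V r, c + (a + b + c) = a + b := by
    intro a b c; rw [add_comm (a + b), vadd_cancel]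
  intro z w
  rcases x with a | a <;> rcases y with b | b <;> simp at hxy <;>
    rcases z with c | c <;> rcases w with d | d <;> simp [tp, h1, vadd_cancel] <;> abel

theorem Pp_cross {r : ℕ} {τ : Equiv.Perm (V r)} {x y : Pt r} (hxy : x.isLeft ≠ y.isLeft)
    (hp : Pp τ x y) (u v : V r) : τ (u + v) = τ u + τ v := by
  rcases x with a | a <;> rcases y with b | b <;> simp at hxy
  · have := hp (.inl (a + u)) (.inl (a + u + v))
    simp only [tp, vadd_cancel, Sum.inr.injEq] at this
    rw [add_assoc, add_assoc, vadd_cancel, add_right_inj] at this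
    rw [this]
  · have := hp (.inl (b + u)) (.inl (b + u + v))
    simp only [tp, vadd_cancel, Sum.inr.injEq] at this
    rw [add_assoc, add_assoc, vadd_cancel, add_right_inj] at this
    rw [this]

theorem Pp_all {r : ℕ} {τ : Equiv.Perm (V r)} (ha : ∀ u v, τ (u + v) = τ u + τ v)
    (x y : Pt r) : Pp τ x y := by
  have ha' : ∀ u v, τ.symm (u + v) = τ.symm u + τ.symm v := by
    intro u v; rw [Equiv.symm_apply_eq, ha]; simp
  intro z w
  rcases x with a | a <;> rcases y with b | b <;>
    rcases z with c | c <;> rcases w with d | d <;>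
    simp [tp, ha, ha', vadd_cancel, vadd_self, add_comm, add_left_comm, add_assoc]

/-- affine maps act on the syndrome of even words -/
theorem aff_sum {r : ℕ} (A : V r → V r) (hA : ∀ a b c, A (a + b + c) = A a + A b + A c)
    (u : V r → ZMod 2) (hu : ∑ a, u a = 0) :
    ∑ a, u a • A a = A (∑ a, u a • a) + A 0 := by
  have hadd : ∀ a b, A (a + b) + A 0 = (A a + A 0) + (A b + A 0) := by
    intro a b
    have := hA a 0 b
    rw [add_zero] at this
    rw [this]; abel
  let f : V r →+ V r := ⟨⟨fun a => A a + A 0, vadd_self _⟩, hadd⟩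
  have hs : ∀ (t : ZMod 2) (a : V r), f (t • a) = t • f a := by
    intro t a
    have : t = 0 ∨ t = 1 := by revert t; decide
    rcases this with rfl | rfl <;> simp
  change _ = f _
  rw [map_sum]
  simp only [hs]
  change _ = ∑ a, u a • (A a + A 0)
  simp only [smul_add, Finset.sum_add_distrib]
  rw [← Finset.sum_smul, hu]; simp

theorem code_sub {r : ℕ} {τ τ' : Equiv.Perm (V r)} (π : Equiv.Perm (Pt r))
    (h : ∀ x y z, π (tp τ x y z) = tp τ' (π x) (π y) (π z))
    (hh : ∀ x y, (π x).isLeft = (π y).isLeft ↔ x.isLeft = y.isLeft)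
    (u : Pt r → ZMod 2) (hu : u ∈ Scode τ) : permAct π u ∈ Scode τ' := by
  have key : ∀ {M : Type} [AddCommGroup M] [Module (ZMod 2) M] (f : Pt r → M),
      ∑ p, permAct π u p • f p = ∑ a, u (Sum.inl a) • f (π (Sum.inl a))
        + ∑ a, u (Sum.inr a) • f (π (Sum.inr a)) := by
    intro M _ _ f
    rw [← Fintype.sum_sum_type (fun p => u p • f (π p))]
    rw [← Equiv.sum_comp π]
    simp [permAct]
  have c1 : ∑ a, permAct π u (Sum.inl a) = ∑ p, permAct π u p • fpL p := by
    rw [Fintype.sum_sum_type]; simp [fpL]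
  have c2 : ∑ a, permAct π u (Sum.inr a) = ∑ p, permAct π u p • fpR p := by
    rw [Fintype.sum_sum_type]; simp [fpR]
  have c3 : ∑ a, permAct π u (Sum.inl a) • a = ∑ p, permAct π u p • fsL p := by
    rw [Fintype.sum_sum_type]; simp [fsL]
  have c4 : ∑ a, permAct π u (Sum.inr a) • a = ∑ p, permAct π u p • fsR p := by
    rw [Fintype.sum_sum_type]; simp [fsR]
  rw [mem_Scode] at hu ⊢
  obtain ⟨e1, e2, e3⟩ := hu
  rw [c1, c2, c3, c4, key, key, key, key]
  have hLR : (∀ a, (π (.inl a)).isLeft = true) ∧ (∀ a, (π (.inr a)).isLeft = false) ∨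
      (∀ a, (π (.inl a)).isLeft = false) ∧ (∀ a, (π (.inr a)).isLeft = true) := by
    have hl : ∀ a, (π (.inl a)).isLeft = (π (.inl 0)).isLeft := fun a => (hh _ _).2 rfl
    have hr : ∀ a, (π (.inr a)).isLeft = !(π (.inl 0)).isLeft := by
      intro a
      have := mt (hh (.inr a) (.inl 0)).1 (by simp)
      revert this
      cases (π (.inr a)).isLeft <;> cases (π (.inl 0)).isLeft <;> simp
    cases hb : (π (.inl 0)).isLeft
    · right; simp [hl, hr, hb]
    · left; simp [hl, hr, hb]
  rcases hLR with ⟨hl, hr⟩ | ⟨hl, hr⟩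
  · have hl' : ∀ a, ∃ b, π (.inl a) = .inl b := fun a => Sum.isLeft_iff.1 (hl a)
    have hr' : ∀ a, ∃ b, π (.inr a) = .inr b := fun a =>
      Sum.isRight_iff.1 (by simpa using hr a)
    choose A hA using hl'
    choose B hB using hr'
    have hA3 : ∀ a b c, A (a + b + c) = A a + A b + A c := by
      intro a b c; simpa [tp, hA] using h (.inl a) (.inl b) (.inl c)
    have hB3 : ∀ a b c, B (a + b + c) = B a + B b + B c := by
      intro a b c; simpa [tp, hB] using h (.inr a) (.inr b) (.inr c)
    have hAB : ∀ a b c, B (c + τ (a + b)) = B c + τ' (A a + A b) := by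
      intro a b c; simpa [tp, hA, hB] using h (.inl a) (.inl b) (.inr c)
    simp only [hA, hB, fpL, fpR, fsL, fsR, Sum.elim_inl, Sum.elim_inr, id, smul_zero,
      Finset.sum_const_zero, add_zero, zero_add, smul_eq_mul, mul_one, mul_zero, e1, e2,
      aff_sum A hA3 _ e1, aff_sum B hB3 _ e2, true_and]
    have := hAB (∑ a, u (Sum.inl a) • a) 0 0
    rw [add_zero, zero_add, e3] at this
    rw [this, add_comm (B 0), add_assoc, vadd_self, add_zero]
  · have hl' : ∀ a, ∃ b, π (.inl a) = .inr b := fun a =>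
      Sum.isRight_iff.1 (by simpa using hl a)
    have hr' : ∀ a, ∃ b, π (.inr a) = .inl b := fun a => Sum.isLeft_iff.1 (hr a)
    choose A hA using hl'
    choose B hB using hr'
    have hA3 : ∀ a b c, A (a + b + c) = A a + A b + A c := by
      intro a b c; simpa [tp, hA] using h (.inl a) (.inl b) (.inl c)
    have hB3 : ∀ a b c, B (a + b + c) = B a + B b + B c := by
      intro a b c; simpa [tp, hB] using h (.inr a) (.inr b) (.inr c)
    have hAB : ∀ a b c, B (c + τ (a + b)) = B c + τ'.symm (A a + A b) := by
      intro a b c; simpa [tp, hA, hB] using h (.inl a) (.inl b) (.inr c)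
    simp only [hA, hB, fpL, fpR, fsL, fsR, Sum.elim_inl, Sum.elim_inr, id, smul_zero,
      Finset.sum_const_zero, add_zero, zero_add, smul_eq_mul, mul_one, mul_zero, e1, e2,
      aff_sum A hA3 _ e1, aff_sum B hB3 _ e2, true_and]
    have := hAB (∑ a, u (Sum.inl a) • a) 0 0
    rw [add_zero, zero_add, e3] at this
    rw [this, add_comm (B 0), add_assoc, vadd_self, add_zero]
    simp

theorem code_eq {r : ℕ} {τ τ' : Equiv.Perm (V r)} (π : Equiv.Perm (Pt r))
    (h : ∀ x y z, π (tp τ x y z) = tp τ' (π x) (π y) (π z))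
    (hh : ∀ x y, (π x).isLeft = (π y).isLeft ↔ x.isLeft = y.isLeft) :
    permAct π '' Scode τ = Scode τ' := by
  apply Set.Subset.antisymm
  · rintro _ ⟨u, hu, rfl⟩
    exact code_sub π h hh u hu
  · intro u hu
    refine ⟨permAct π.symm u, code_sub π.symm ?_ ?_ u hu, by funext p; simp [permAct]⟩
    · intro x y z; rw [Equiv.symm_apply_eq, h]; simp
    · intro x y; rw [← hh]; simp

theorem Scode_of_SQS {r : ℕ} {τ τ' : Equiv.Perm (V r)} (h0 : τ 0 = 0) (h0' : τ' 0 = 0)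
    (π : Equiv.Perm (Pt r)) (hπ : qAct π (SQS τ) = SQS τ') :
    ∃ ρ : Equiv.Perm (Pt r), permAct ρ '' Scode τ = Scode τ' := by
  have h := tp_hom h0 h0' π hπ
  by_cases ha' : ∀ u v, τ' (u + v) = τ' u + τ' v
  · have ha : ∀ u v, τ (u + v) = τ u + τ v :=
      Pp_cross (x := .inl 0) (y := .inr 0) (by simp) ((Pp_hom π h _ _).2 (Pp_all ha' _ _))
    have has : ∀ u v, τ.symm (u + v) = τ.symm u + τ.symm v := by
      intro u v; rw [Equiv.symm_apply_eq, ha]; simp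
    have has' : ∀ u v, τ'.symm (u + v) = τ'.symm u + τ'.symm v := by
      intro u v; rw [Equiv.symm_apply_eq, ha']; simp
    refine ⟨Equiv.sumCongr (Equiv.refl _) (τ.symm.trans τ'), code_eq _ ?_ ?_⟩
    · intro x y z
      rcases x with a | a <;> rcases y with b | b <;> rcases z with c | c <;>
        simp [tp, ha, ha', has, has']
    · intro x y
      rcases x with a | a <;> rcases y with b | b <;> simp
  · refine ⟨π, code_eq π h ?_⟩
    have hsame : ∀ x y : Pt r, x.isLeft = y.isLeft → (π x).isLeft = (π y).isLeft := by
      intro x y hxy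
      by_contra hne
      exact ha' (Pp_cross hne ((Pp_hom π h x y).1 (Pp_same hxy)))
    intro x y
    refine ⟨?_, hsame x y⟩
    intro hxy
    by_contra hne
    have hall : ∀ p, (π p).isLeft = (π x).isLeft := by
      intro p
      by_cases hp : p.isLeft = x.isLeft
      · exact hsame _ _ hp
      · have : p.isLeft = y.isLeft := by
          revert hp hne
          cases p.isLeft <;> cases x.isLeft <;> cases y.isLeft <;> simp
        rw [hsame _ _ this, hxy]
    have e1 := hall (π.symm (.inl 0))
    have e2 := hall (π.symm (.inr 0))
    rw [← e2] at e1
    simp at e1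

/-- for transitive codes `S_τ`, `S_{τ'}`, there are `x`, `π` with
`x + π(S_τ) = S_{τ'}` iff some permutation maps `SQS_τ` onto `SQS_{τ'}`. -/
theorem Scode_iso_iff_SQS_iso {r : ℕ} (τ τ' : Equiv.Perm (V r))
    (h0 : τ 0 = 0) (h0' : τ' 0 = 0)
    (ht : IsTransitiveCode (Scode τ)) (ht' : IsTransitiveCode (Scode τ')) :
    (∃ (x : Pt r → ZMod 2) (π : Equiv.Perm (Pt r)),
        (fun y => x + permAct π y) '' Scode τ = Scode τ') ↔
      ∃ π' : Equiv.Perm (Pt r), qAct π' (SQS τ) = SQS τ' := by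
  constructor
  · rintro ⟨x, π, h⟩
    have z0 : ∀ σ : Equiv.Perm (V r), σ 0 = 0 → (0 : Pt r → ZMod 2) ∈ Scode σ := by
      intro σ hσ; rw [mem_Scode]; simp [hσ]
    have p0 : ∀ σ : Equiv.Perm (Pt r), permAct σ 0 = 0 := fun σ => rfl
    have hx : x ∈ Scode τ' := by
      rw [← h]; exact ⟨0, z0 τ h0, by simp [p0]⟩
    obtain ⟨x', π', h', hx'⟩ := ht' x hx 0 (z0 τ' h0')
    refine ⟨π.trans π', SQS_of_Scode h0 h0' _ ?_⟩
    rw [← h', ← h, Set.image_image]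
    apply Set.image_congr
    intro u _
    have : permAct π' (x + permAct π u) = permAct π' x + permAct (π.trans π') u := rfl
    rw [this, ← add_assoc, hx', zero_add]
  · rintro ⟨π, h⟩
    obtain ⟨ρ, hρ⟩ := Scode_of_SQS h0 h0' π h
    exact ⟨0, ρ, by simpa using hρ⟩
end

section
/- For every permutation τ of the vectors of F^3 with τ(0) = 0, the extended perfect code S_τ of length 16 is neighbor transitive; in particular, Aut(S_τ) acts transitively on the codewords of S_τ and PAut(S_τ) acts transitively on the 16 coordinate positions. -/
open Finset

namespace SC

/-- binary expansion of a number as a vector of `F^3` -/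
def e (n : ℕ) : V 3 := fun i => if n.testBit i then 1 else 0

theorem e_xor (m n : ℕ) : e (m ^^^ n) = e m + e n := by
  funext i
  simp only [e, Nat.testBit_xor, Pi.add_apply]
  cases m.testBit i <;> cases n.testBit i <;> decide

theorem e_surj : ∀ v : V 3, ∃ n < 8, e n = v := by decide +kernel

theorem e_inj : ∀ m < 8, ∀ n < 8, e m = e n → m = n := by decide +kernel

theorem e_zero : e 0 = 0 := by decide +kernel

def lin (a b c n : ℕ) : ℕ :=
  (if n.testBit 0 then a else 0) ^^^ (if n.testBit 1 then b else 0) ^^^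
    (if n.testBit 2 then c else 0)

def linV (a b c : V 3) : V 3 →ₗ[ZMod 2] V 3 where
  toFun x := x 0 • a + x 1 • b + x 2 • c
  map_add' x y := by simp only [Pi.add_apply, add_smul]; abel
  map_smul' r x := by simp [smul_smul]

theorem linV_apply (a b c x : V 3) : linV a b c x = x 0 • a + x 1 • b + x 2 • c := rfl

theorem e_lin (a b c n : ℕ) : e (lin a b c n) = linV (e a) (e b) (e c) (e n) := by
  have h : ∀ (p : Bool) (a : ℕ), e (if p then a else 0) = (if p then (1 : ZMod 2) else 0) • e a := by
    intro p a
    cases p <;> simp [e_zero]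
  simp only [lin, e_xor, linV_apply, h]
  rfl

/-- table of a permutation fixing `0` and the three basis vectors -/
def tab (p q r s : ℕ) : ℕ → ℕ
  | 0 => 0
  | 1 => 1
  | 2 => 2
  | 3 => p
  | 4 => 4
  | 5 => q
  | 6 => r
  | _ => s

def okLin (a b c : ℕ) : Bool :=
  (List.range 8).all fun n => decide (lin a b c n < 8) && (n == 0 || lin a b c n != 0)

def someTriple (P : ℕ → ℕ → ℕ → Bool) : Bool :=
  (List.range 8).any fun a => (List.range 8).any fun b => (List.range 8).any fun c =>
    okLin a b c && P a b c

def chkInv (t : ℕ → ℕ) : Bool :=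
  someTriple fun a b c => (List.range 8).all fun n =>
    t (lin a b c (t n)) == lin (t a) (t b) (t c) n

def chkShift (t : ℕ → ℕ) (d : ℕ) : Bool :=
  someTriple fun a b c => (List.range 8).all fun n =>
    decide (d ^^^ lin a b c n < 8) &&
    t (d ^^^ lin a b c n) ==
      t d ^^^ lin (t (d ^^^ a) ^^^ t d) (t (d ^^^ b) ^^^ t d) (t (d ^^^ c) ^^^ t d) (t n)

theorem chk_all : ∀ p ∈ [3, 5, 6, 7], ∀ q ∈ [3, 5, 6, 7], p ≠ q → ∀ r ∈ [3, 5, 6, 7],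
    p ≠ r → q ≠ r → ∀ s ∈ [3, 5, 6, 7], p ≠ s → q ≠ s → r ≠ s →
    (chkInv (tab p q r s) && (List.range 8).all fun d => chkShift (tab p q r s) d) = true := by
  decide +kernel

theorem tab_lt : ∀ p ∈ [3, 5, 6, 7], ∀ q ∈ [3, 5, 6, 7], ∀ r ∈ [3, 5, 6, 7],
    ∀ s ∈ [3, 5, 6, 7], ∀ n < 8, tab p q r s n < 8 := by
  decide +kernel

theorem okLin_inj {a b c : ℕ} (h : okLin a b c = true) :
    Function.Injective (linV (e a) (e b) (e c)) := by
  rw [injective_iff_map_eq_zero]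
  intro x hx
  obtain ⟨n, hn, rfl⟩ := e_surj x
  rw [← e_lin, ← e_zero] at hx
  simp only [okLin, List.all_eq_true, List.mem_range, Bool.and_eq_true, decide_eq_true_eq,
    Bool.or_eq_true, beq_iff_eq, bne_iff_ne] at h
  obtain ⟨h1, h2⟩ := h n hn
  have := e_inj _ h1 0 (by norm_num) hx
  rcases h2 with h2 | h2
  · rw [h2, e_zero]
  · exact absurd this h2

theorem someTriple_spec {P : ℕ → ℕ → ℕ → Bool} (h : someTriple P = true) :
    ∃ a b c, a < 8 ∧ b < 8 ∧ c < 8 ∧ okLin a b c = true ∧ P a b c = true := by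
  simp only [someTriple, List.any_eq_true, List.mem_range, Bool.and_eq_true] at h
  obtain ⟨a, ha, b, hb, c, hc, h⟩ := h
  exact ⟨a, b, c, ha, hb, hc, h⟩

/-- The property of `τ` we need. -/
def Good (τ : Equiv.Perm (V 3)) : Prop :=
  (∃ A B : V 3 ≃ₗ[ZMod 2] V 3, ∀ u, τ (B (τ u)) = A u) ∧
  ∀ a, ∃ A B : V 3 ≃ₗ[ZMod 2] V 3, ∀ u, τ (a + A u) = τ a + B (τ u)

theorem good_of_tab (τ : Equiv.Perm (V 3)) (t : ℕ → ℕ) (h0 : t 0 = 0)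
    (ht : ∀ n < 8, t n < 8) (hτ : ∀ n < 8, τ (e n) = e (t n))
    (h1 : chkInv t = true) (h2 : ∀ d < 8, chkShift t d = true) : Good τ := by
  constructor
  · obtain ⟨a, b, c, ha, hb, hc, hok, h⟩ := someTriple_spec h1
    simp only [List.all_eq_true, List.mem_range, beq_iff_eq] at h
    have hinj := okLin_inj hok
    set B := linV (e a) (e b) (e c) with hB
    set A := linV (e (t a)) (e (t b)) (e (t c)) with hA
    have key : ∀ u, τ (B (τ u)) = A u := by
      intro u
      obtain ⟨n, hn, rfl⟩ := e_surj u
      have hlt : lin a b c (t n) < 8 := by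
        simp only [okLin, List.all_eq_true, List.mem_range, Bool.and_eq_true,
          decide_eq_true_eq] at hok
        exact (hok _ (ht n hn)).1
      rw [hτ n hn, hB, ← e_lin, hτ _ hlt, h n hn, e_lin]
    have hAinj : Function.Injective A := by
      intro x y hxy
      rw [← key, ← key] at hxy
      exact τ.injective (hinj (τ.injective hxy))
    exact ⟨LinearEquiv.ofInjectiveEndo A hAinj, LinearEquiv.ofInjectiveEndo B hinj, key⟩
  · intro v
    obtain ⟨d, hd, rfl⟩ := e_surj v
    obtain ⟨a, b, c, ha, hb, hc, hok, h⟩ := someTriple_spec (h2 d hd)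
    simp only [List.all_eq_true, List.mem_range, beq_iff_eq, Bool.and_eq_true,
      decide_eq_true_eq] at h
    have hinj := okLin_inj hok
    set A := linV (e a) (e b) (e c) with hA
    set B := linV (e (t (d ^^^ a) ^^^ t d)) (e (t (d ^^^ b) ^^^ t d))
      (e (t (d ^^^ c) ^^^ t d)) with hB
    have key : ∀ u, τ (e d + A u) = τ (e d) + B (τ u) := by
      intro u
      obtain ⟨n, hn, rfl⟩ := e_surj u
      rw [hτ n hn, hA, ← e_lin, ← e_xor, hτ _ (h n hn).1, (h n hn).2, hB, ← e_lin, e_xor,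
        hτ d hd]
    have hBinj : Function.Injective B := by
      intro x y hxy
      have hx := key (τ.symm x)
      have hy := key (τ.symm y)
      rw [Equiv.apply_symm_apply] at hx hy
      rw [hxy, ← hy] at hx
      exact τ.symm.injective (hinj (add_left_cancel (τ.injective hx)))
    exact ⟨LinearEquiv.ofInjectiveEndo A hinj, LinearEquiv.ofInjectiveEndo B hBinj, key⟩

theorem good_of_normal (τ : Equiv.Perm (V 3)) (h0 : τ (e 0) = e 0) (h1 : τ (e 1) = e 1)
    (h2 : τ (e 2) = e 2) (h4 : τ (e 4) = e 4) : Good τ := by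
  have hex : ∀ n ∈ [3, 5, 6, 7], ∃ m ∈ [3, 5, 6, 7], τ (e n) = e m := by
    intro n hn
    have hn8 : n < 8 := by
      revert n; decide
    obtain ⟨m, hm, hh⟩ := e_surj (τ (e n))
    have hne : ∀ k < 8, τ (e k) = e k → m = k → n = k := by
      intro k hk hk1 hmk
      subst hmk
      rw [hh] at hk1
      exact e_inj _ hn8 _ hk (τ.injective (hk1 ▸ hh.symm ▸ rfl))
    refine ⟨m, ?_, hh.symm⟩
    have a0 := hne 0 (by norm_num) h0
    have a1 := hne 1 (by norm_num) h1
    have a2 := hne 2 (by norm_num) h2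
    have a4 := hne 4 (by norm_num) h4
    simp only [List.mem_cons, List.not_mem_nil, or_false] at hn ⊢
    omega
  obtain ⟨p, hp, hp'⟩ := hex 3 (by decide)
  obtain ⟨q, hq, hq'⟩ := hex 5 (by decide)
  obtain ⟨r, hr, hr'⟩ := hex 6 (by decide)
  obtain ⟨s, hs, hs'⟩ := hex 7 (by decide)
  have hne : ∀ m n x y, m < 8 → n < 8 → m ≠ n → τ (e m) = e x → τ (e n) = e y → x ≠ y := by
    intro m n x y hm hn hmn hx hy hxy
    subst hxy
    exact hmn (e_inj m hm n hn (τ.injective (hx.trans hy.symm)))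
  have hc := chk_all p hp q hq (hne 3 5 _ _ (by decide) (by decide) (by decide) hp' hq')
    r hr (hne 3 6 _ _ (by decide) (by decide) (by decide) hp' hr')
    (hne 5 6 _ _ (by decide) (by decide) (by decide) hq' hr')
    s hs (hne 3 7 _ _ (by decide) (by decide) (by decide) hp' hs')
    (hne 5 7 _ _ (by decide) (by decide) (by decide) hq' hs')
    (hne 6 7 _ _ (by decide) (by decide) (by decide) hr' hs')
  simp only [Bool.and_eq_true, List.all_eq_true, List.mem_range] at hc
  refine good_of_tab τ (tab p q r s) rfl (tab_lt p hp q hq r hr s hs) ?_ hc.1 hc.2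
  intro n hn
  interval_cases n <;> assumption

theorem good_transfer (τ σ : Equiv.Perm (V 3)) (M N : V 3 ≃ₗ[ZMod 2] V 3)
    (h : ∀ u, τ u = N (σ (M u))) (hg : Good σ) : Good τ := by
  obtain ⟨⟨A, B, h1⟩, h2⟩ := hg
  constructor
  · refine ⟨(M.trans A).trans N, (N.symm.trans B).trans M.symm, fun u => ?_⟩
    simp [h, h1]
  · intro a
    obtain ⟨A, B, h2⟩ := h2 (M a)
    refine ⟨(M.trans A).trans M.symm, (N.symm.trans B).trans N, fun u => ?_⟩
    simp [h, h2]

theorem zcases : ∀ x : ZMod 2, x = 0 ∨ x = 1 := by decide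

theorem vadd (a : V 3) : a + a = 0 := by
  funext i; exact CharTwo.add_self_eq_zero _

theorem veq {a b : V 3} (h : a + b = 0) : a = b := by
  have : a + b + b = b := by rw [h, zero_add]
  rwa [add_assoc, vadd, add_zero] at this

theorem linV_inj {a b c : V 3} (ha : a ≠ 0) (hb : b ≠ 0) (hab : a ≠ b) (hc : c ≠ 0)
    (hca : c ≠ a) (hcb : c ≠ b) (hcab : c ≠ a + b) : Function.Injective (linV a b c) := by
  rw [injective_iff_map_eq_zero]
  intro x hx
  rw [linV_apply] at hx
  rcases zcases (x 0) with h0 | h0 <;> rcases zcases (x 1) with h1 | h1 <;>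
    rcases zcases (x 2) with h2 | h2 <;> rw [h0, h1, h2] at hx <;>
    simp only [zero_smul, one_smul, zero_add, add_zero] at hx
  · funext i; fin_cases i <;> assumption
  · exact absurd hx hc
  · exact absurd hx hb
  · exact absurd (veq hx).symm hcb
  · exact absurd hx ha
  · exact absurd (veq hx).symm hca
  · exact absurd (veq hx) hab
  · exact absurd (veq hx).symm hcab

theorem good_basis (τ : Equiv.Perm (V 3)) (h0 : τ 0 = 0)
    (h : τ (e 4) ≠ τ (e 1) + τ (e 2)) : Good τ := by
  have hne : ∀ m n, m < 8 → n < 8 → m ≠ n → τ (e m) ≠ τ (e n) := by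
    intro m n hm hn hmn hx
    exact hmn (e_inj m hm n hn (τ.injective hx))
  have h0' : τ (e 0) = 0 := by rw [e_zero, h0]
  have hinj := @linV_inj (τ (e 1)) (τ (e 2)) (τ (e 4))
    (h0' ▸ hne 1 0 (by decide) (by decide) (by decide))
    (h0' ▸ hne 2 0 (by decide) (by decide) (by decide))
    (hne 1 2 (by decide) (by decide) (by decide))
    (h0' ▸ hne 4 0 (by decide) (by decide) (by decide))
    (hne 4 1 (by decide) (by decide) (by decide))
    (hne 4 2 (by decide) (by decide) (by decide)) h
  let N := LinearEquiv.ofInjectiveEndo _ hinj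
  have hN : ∀ u, N u = linV (τ (e 1)) (τ (e 2)) (τ (e 4)) u := fun u => rfl
  refine good_transfer τ (τ.trans N.symm.toEquiv) (LinearEquiv.refl _ _) N (fun u => ?_) ?_
  · simp
  · have hs : ∀ x y, N y = x → N.symm.toEquiv x = y := by
      rintro x y rfl
      exact N.symm_apply_apply y
    apply good_of_normal
    · rw [Equiv.trans_apply, h0', e_zero]
      exact map_zero N.symm
    all_goals
      rw [Equiv.trans_apply]
      apply hs
      rw [hN, linV_apply]
      simp [e, Nat.testBit]

theorem good_all (τ : Equiv.Perm (V 3)) (h0 : τ 0 = 0) : Good τ := by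
  by_cases h : τ (e 4) = τ (e 1) + τ (e 2)
  · have hinj : Function.Injective (linV (e 1) (e 2) (e 5)) := okLin_inj (by decide +kernel)
    let M := LinearEquiv.ofInjectiveEndo _ hinj
    have hM : ∀ a b c n, a = 1 → b = 2 → c = 5 → M (e n) = e (lin a b c n) := by
      rintro a b c n rfl rfl rfl
      rw [e_lin]; rfl
    refine good_transfer τ (M.toEquiv.trans τ) M.symm (LinearEquiv.refl _ _) (fun u => ?_) ?_
    · simp
    · apply good_basis
      · simp [h0]
      · have m1 : M (e 1) = e 1 := hM _ _ _ _ rfl rfl rfl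
        have m2 : M (e 2) = e 2 := hM _ _ _ _ rfl rfl rfl
        have m4 : M (e 4) = e 5 := hM _ _ _ _ rfl rfl rfl
        intro hh
        have hh' : τ (M (e 4)) = τ (M (e 1)) + τ (M (e 2)) := hh
        rw [m1, m2, m4, ← h] at hh'
        have := e_inj _ (by norm_num) _ (by norm_num) (τ.injective hh')
        omega
  · exact good_basis τ h0 h

/-- parity of a word -/
def par : (V 3 → ZMod 2) →ₗ[ZMod 2] ZMod 2 where
  toFun x := ∑ a : V 3, x a
  map_add' x y := by simp [Finset.sum_add_distrib]
  map_smul' r x := by simp [Finset.mul_sum]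

/-- syndrome of a word -/
def syn : (V 3 → ZMod 2) →ₗ[ZMod 2] V 3 where
  toFun x := ∑ a : V 3, x a • a
  map_add' x y := by simp only [Pi.add_apply, add_smul, Finset.sum_add_distrib]
  map_smul' r x := by
    simp only [Pi.smul_apply, smul_eq_mul, mul_smul, RingHom.id_apply, Finset.smul_sum]

theorem par_apply (x : V 3 → ZMod 2) : par x = ∑ a : V 3, x a := rfl

theorem syn_apply (x : V 3 → ZMod 2) : syn x = ∑ a : V 3, x a • a := rfl

theorem par_unit (a : V 3) : par (unitVec a) = 1 := by
  simp [par_apply, unitVec]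

theorem syn_unit (a : V 3) : syn (unitVec a) = a := by
  simp [syn_apply, unitVec, ite_smul]

theorem mem_ham (x : V 3 → ZMod 2) : x ∈ extHamming 3 ↔ syn x = 0 ∧ par x = 0 := Iff.rfl

theorem wadd {ι : Type} (x : ι → ZMod 2) : x + x = 0 := by
  funext i; exact CharTwo.add_self_eq_zero _

theorem zz : (1 : ZMod 2) + 1 = 0 := by decide

/-- left half of a word -/
def lh (z : Pt 3 → ZMod 2) : V 3 → ZMod 2 := fun a => z (Sum.inl a)

/-- right half of a word -/
def rh (z : Pt 3 → ZMod 2) : V 3 → ZMod 2 := fun a => z (Sum.inr a)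

theorem lh_add (x y : Pt 3 → ZMod 2) : lh (x + y) = lh x + lh y := rfl
theorem rh_add (x y : Pt 3 → ZMod 2) : rh (x + y) = rh x + rh y := rfl

theorem ext_half {x y : Pt 3 → ZMod 2} (hl : lh x = lh y) (hr : rh x = rh y) : x = y := by
  funext i
  cases i with
  | inl a => exact congrFun hl a
  | inr a => exact congrFun hr a

theorem mem_code (τ : Equiv.Perm (V 3)) (z : Pt 3 → ZMod 2) :
    z ∈ Scode τ ↔ par (lh z) = 0 ∧ par (rh z) = 0 ∧ τ (syn (lh z)) = syn (rh z) := by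
  constructor
  · intro h
    simp only [Scode, Set.mem_iUnion, Set.mem_ofPred_eq, mem_ham] at h
    obtain ⟨a, h1, ⟨hs1, hp1⟩, h2, ⟨hs2, hp2⟩, rfl⟩ := h
    have hl : ∀ f g : V 3 → ZMod 2, lh (Sum.elim f g) = f := fun f g => rfl
    have hr : ∀ f g : V 3 → ZMod 2, rh (Sum.elim f g) = g := fun f g => rfl
    rw [hl, hr]
    simp only [map_add, par_unit, syn_unit, hs1, hp1, hs2, hp2, zz, zero_add, add_zero, and_self]
  · rintro ⟨h1, h2, h3⟩
    simp only [Scode, Set.mem_iUnion, Set.mem_ofPred_eq, mem_ham]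
    refine ⟨syn (lh z), lh z + unitVec (syn (lh z)) + unitVec 0, ?_,
      rh z + unitVec (τ (syn (lh z))) + unitVec 0, ?_, ?_⟩
    · simp only [map_add, par_unit, syn_unit, h1, zz, zero_add, add_zero, vadd, and_self]
    · simp only [map_add, par_unit, syn_unit, h2, h3, zz, zero_add, add_zero, vadd, and_self]
    · have key : ∀ x u v : V 3 → ZMod 2, x + u + v + u + v = x := by
        intro x u v
        have : x + u + v + u + v = x + (u + u) + (v + v) := by abel
        rw [this, wadd, wadd, add_zero, add_zero]
      apply ext_half
      · exact (key _ _ _).symm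
      · exact (key _ _ _).symm

theorem par_aff (c : V 3) (A : V 3 ≃ₗ[ZMod 2] V 3) (w : V 3 → ZMod 2) :
    par (permAct (affEquiv c A) w) = par w := by
  rw [par_apply, par_apply]
  exact Equiv.sum_comp (affEquiv c A).symm w

theorem syn_aff (c : V 3) (A : V 3 ≃ₗ[ZMod 2] V 3) (w : V 3 → ZMod 2) :
    syn (permAct (affEquiv c A) w) = par w • c + A (syn w) := by
  rw [syn_apply, syn_apply, par_apply]
  rw [← Equiv.sum_comp (affEquiv c A)]
  simp only [permAct, Equiv.symm_apply_apply, map_sum, map_smul, Finset.sum_smul,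
    ← Finset.sum_add_distrib, ← smul_add]
  rfl

section
variable {ι : Type}

/-- automorphism pairs -/
def IsAut (C : Set (ι → ZMod 2)) (x : ι → ZMod 2) (π : Equiv.Perm ι) : Prop :=
  ∀ y, x + permAct π y ∈ C ↔ y ∈ C

theorem permAct_add (π : Equiv.Perm ι) (x y : ι → ZMod 2) :
    permAct π (x + y) = permAct π x + permAct π y := rfl

theorem permAct_permAct_symm (π : Equiv.Perm ι) (x : ι → ZMod 2) :
    permAct π (permAct π.symm x) = x := by
  funext i; simp [permAct]

theorem permAct_symm_permAct (π : Equiv.Perm ι) (x : ι → ZMod 2) :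
    permAct π.symm (permAct π x) = x := by
  funext i; simp [permAct]

theorem add_add_self (x y : ι → ZMod 2) : x + (x + y) = y := by
  rw [← add_assoc, wadd, zero_add]

theorem IsAut.image {C : Set (ι → ZMod 2)} {x : ι → ZMod 2} {π : Equiv.Perm ι}
    (h : IsAut C x π) : (fun y => x + permAct π y) '' C = C := by
  ext z
  constructor
  · rintro ⟨y, hy, rfl⟩
    exact (h y).2 hy
  · intro hz
    have hh : x + permAct π (permAct π.symm (x + z)) = z := by
      rw [permAct_permAct_symm, add_add_self]
    refine ⟨permAct π.symm (x + z), ?_, hh⟩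
    rw [← h, hh]
    exact hz

/-- two words in the same orbit of the automorphism group -/
def Rel (C : Set (ι → ZMod 2)) (y y' : ι → ZMod 2) : Prop :=
  ∃ x π, IsAut C x π ∧ x + permAct π y = y'

theorem Rel.trans {C : Set (ι → ZMod 2)} {a b c : ι → ZMod 2} (h : Rel C a b)
    (h' : Rel C b c) : Rel C a c := by
  obtain ⟨x, π, h1, rfl⟩ := h
  obtain ⟨x', π', h2, rfl⟩ := h'
  have key : ∀ y, x' + permAct π' x + permAct (π.trans π') y =
      x' + permAct π' (x + permAct π y) := by
    intro y
    rw [permAct_add, add_assoc]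
    rfl
  refine ⟨x' + permAct π' x, π.trans π', fun y => ?_, key a⟩
  rw [key, h2, h1]

theorem Rel.symm {C : Set (ι → ZMod 2)} {a b : ι → ZMod 2} (h : Rel C a b) : Rel C b a := by
  obtain ⟨x, π, h1, rfl⟩ := h
  refine ⟨permAct π.symm x, π.symm, fun y => ?_, ?_⟩
  · rw [← permAct_add, ← h1, permAct_permAct_symm, add_add_self]
  · rw [← permAct_add, add_add_self, permAct_symm_permAct]

theorem Rel.out {C : Set (ι → ZMod 2)} {a b : ι → ZMod 2} (h : Rel C a b) :
    ∃ (x : ι → ZMod 2) (π : Equiv.Perm ι),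
      (fun y => x + permAct π y) '' C = C ∧ x + permAct π a = b := by
  obtain ⟨x, π, h1, h2⟩ := h
  exact ⟨x, π, h1.image, h2⟩

end

theorem aut_aff {τ : Equiv.Perm (V 3)} {x : Pt 3 → ZMod 2} (hx : x ∈ Scode τ)
    {A B : V 3 ≃ₗ[ZMod 2] V 3} (c d : V 3)
    (h : ∀ u, τ (syn (lh x) + A u) = τ (syn (lh x)) + B (τ u)) :
    IsAut (Scode τ) x (Equiv.sumCongr (affEquiv c A) (affEquiv d B)) := by
  intro y
  rw [mem_code] at hx
  obtain ⟨h1, h2, h3⟩ := hx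
  rw [mem_code, mem_code, lh_add, rh_add]
  have e1 : lh (permAct (Equiv.sumCongr (affEquiv c A) (affEquiv d B)) y) =
    permAct (affEquiv c A) (lh y) := rfl
  have e2 : rh (permAct (Equiv.sumCongr (affEquiv c A) (affEquiv d B)) y) =
    permAct (affEquiv d B) (rh y) := rfl
  rw [e1, e2, map_add par, map_add par, map_add syn, map_add syn, par_aff, par_aff, syn_aff, syn_aff, h1, h2,
    zero_add, zero_add]
  refine and_congr_right fun hp => and_congr_right fun hq => ?_
  rw [hp, hq, zero_smul, zero_smul, zero_add, zero_add, h, ← h3, add_right_inj,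
    B.injective.eq_iff]

theorem zero_mem_code {τ : Equiv.Perm (V 3)} (h0 : τ 0 = 0) : (0 : Pt 3 → ZMod 2) ∈ Scode τ := by
  rw [mem_code]
  have e1 : lh 0 = 0 := rfl
  have e2 : rh 0 = 0 := rfl
  rw [e1, e2, map_zero, map_zero, h0]
  simp

theorem permAct_zero {ι : Type} (π : Equiv.Perm ι) : permAct π 0 = 0 := rfl

theorem rel_zero {τ : Equiv.Perm (V 3)} (hg : Good τ) {x : Pt 3 → ZMod 2}
    (hx : x ∈ Scode τ) : Rel (Scode τ) 0 x := by
  obtain ⟨A, B, h⟩ := hg.2 (syn (lh x))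
  exact ⟨x, _, aut_aff hx 0 0 h, by rw [permAct_zero, add_zero]⟩

theorem aut_trans {τ : Equiv.Perm (V 3)} (h0 : τ 0 = 0) (c d : V 3) :
    IsAut (Scode τ) 0 (Equiv.sumCongr (affEquiv c (LinearEquiv.refl _ _))
      (affEquiv d (LinearEquiv.refl _ _))) := by
  apply aut_aff (zero_mem_code h0)
  intro u
  have e1 : lh 0 = 0 := rfl
  rw [e1, map_zero, h0]
  simp

theorem aut_swap {τ : Equiv.Perm (V 3)} {A B : V 3 ≃ₗ[ZMod 2] V 3}
    (h : ∀ u, τ (B (τ u)) = A u) (c d : V 3) :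
    IsAut (Scode τ) 0 ((Equiv.sumComm (V 3) (V 3)).trans
      (Equiv.sumCongr (affEquiv c B) (affEquiv d A))) := by
  intro y
  rw [zero_add, mem_code, mem_code]
  have e1 : lh (permAct ((Equiv.sumComm (V 3) (V 3)).trans
      (Equiv.sumCongr (affEquiv c B) (affEquiv d A))) y) = permAct (affEquiv c B) (rh y) := rfl
  have e2 : rh (permAct ((Equiv.sumComm (V 3) (V 3)).trans
      (Equiv.sumCongr (affEquiv c B) (affEquiv d A))) y) = permAct (affEquiv d A) (lh y) := rfl
  rw [e1, e2, par_aff, par_aff, syn_aff, syn_aff, and_left_comm]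
  refine and_congr_right fun hp => and_congr_right fun hq => ?_
  rw [hp, hq, zero_smul, zero_smul, zero_add, zero_add, ← h, τ.injective.eq_iff,
    B.injective.eq_iff]
  exact eq_comm

theorem coord {τ : Equiv.Perm (V 3)} (h0 : τ 0 = 0) (hg : Good τ) (i j : Pt 3) :
    ∃ π : Equiv.Perm (Pt 3), IsAut (Scode τ) 0 π ∧ π i = j := by
  have hh : ∀ a b : V 3, a + b + b = a := fun a b => by rw [add_assoc, vadd, add_zero]
  obtain ⟨⟨A, B, h⟩, -⟩ := hg
  cases i with
  | inl a =>
    cases j with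
    | inl b => exact ⟨_, aut_trans h0 (b + a) 0, congrArg Sum.inl (hh b a)⟩
    | inr b => exact ⟨_, aut_swap h 0 (b + A a), congrArg Sum.inr (hh b (A a))⟩
  | inr a =>
    cases j with
    | inl b => exact ⟨_, aut_swap h (b + B a) 0, congrArg Sum.inl (hh b (B a))⟩
    | inr b => exact ⟨_, aut_trans h0 0 (b + a), congrArg Sum.inr (hh b a)⟩

theorem nbr_form {ι : Type} [Fintype ι] [DecidableEq ι] {y c : ι → ZMod 2}
    (h : hammingDist y c = 1) : ∃ i, y = c + Pi.single i 1 := by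
  unfold hammingDist at h
  obtain ⟨i, hi⟩ := Finset.card_eq_one.1 h
  refine ⟨i, funext fun j => ?_⟩
  have hj : y j ≠ c j ↔ j = i := by
    have := Finset.ext_iff.1 hi j
    simpa using this
  rw [Pi.add_apply]
  by_cases hji : j = i
  · subst hji
    rw [Pi.single_eq_same]
    have := hj.2 rfl
    revert this
    generalize y j = p
    generalize c j = q
    revert p q
    decide
  · rw [Pi.single_eq_of_ne hji, add_zero]
    by_contra hne
    exact hji (hj.1 hne)

theorem permAct_single {ι : Type} [DecidableEq ι] (π : Equiv.Perm ι) (i : ι) :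
    permAct π (Pi.single i 1) = Pi.single (π i) 1 := by
  funext j
  simp only [permAct, Pi.single_apply, Equiv.symm_apply_eq]

theorem rel_nbr {τ : Equiv.Perm (V 3)} (h0 : τ 0 = 0) (hg : Good τ) {y : Pt 3 → ZMod 2}
    (hy : y ∈ codeNbrs (Scode τ)) : Rel (Scode τ) y (Pi.single (Sum.inl 0) 1) := by
  obtain ⟨-, c, hc, hd⟩ := hy
  obtain ⟨i, rfl⟩ := nbr_form hd
  obtain ⟨x, π, hA, hx⟩ := (rel_zero hg hc).symm
  have h1 : Rel (Scode τ) (c + Pi.single i 1) (Pi.single (π i) 1) := by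
    refine ⟨x, π, hA, ?_⟩
    rw [permAct_add, ← add_assoc, hx, zero_add, permAct_single]
  obtain ⟨π', h2, h3⟩ := coord h0 hg (π i) (Sum.inl 0)
  refine h1.trans ⟨0, π', h2, ?_⟩
  rw [permAct_single, h3, zero_add]

theorem nt {τ : Equiv.Perm (V 3)} (h0 : τ 0 = 0) (hg : Good τ) :
    NeighborTransitive (Scode τ) ∧ IsTransitiveCode (Scode τ) ∧ CoordTransitive (Scode τ) := by
  have ht : IsTransitiveCode (Scode τ) := fun c hc c' hc' =>
    ((rel_zero hg hc).symm.trans (rel_zero hg hc')).out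
  refine ⟨⟨ht, fun y hy y' hy' => ((rel_nbr h0 hg hy).trans (rel_nbr h0 hg hy').symm).out⟩,
    ht, fun i j => ?_⟩
  obtain ⟨π, h1, h2⟩ := coord h0 hg i j
  refine ⟨π, ?_, h2⟩
  simpa using h1.image

theorem hd_sum (x y : Pt 3 → ZMod 2) :
    hammingDist x y = hammingDist (lh x) (lh y) + hammingDist (rh x) (rh y) := by
  simp only [hammingDist, Finset.card_filter, Fintype.sum_sum_type]
  rfl

theorem par_hd (x y : V 3 → ZMod 2) : par (x + y) = (hammingDist x y : ZMod 2) := by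
  rw [par_apply, hammingDist, Finset.card_filter, Nat.cast_sum]
  refine Finset.sum_congr rfl fun a _ => ?_
  rw [Pi.add_apply]
  generalize x a = p
  generalize y a = q
  revert p q
  decide

theorem hd_even {x y : V 3 → ZMod 2} (h : par (x + y) = 0) : Even (hammingDist x y) := by
  rw [par_hd] at h
  rw [even_iff_two_dvd]
  exact (ZMod.natCast_eq_zero_iff _ _).1 h

theorem hd_ham {x y : V 3 → ZMod 2} (hp : par (x + y) = 0) (hs : syn (x + y) = 0)
    (hne : x ≠ y) : 4 ≤ hammingDist x y := by
  have he := hd_even hp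
  have hpos := hammingDist_pos.2 hne
  have h2 : hammingDist x y ≠ 2 := by
    intro h2
    obtain ⟨a, b, hab, hs2⟩ := Finset.card_eq_two.1 h2
    have hxy : x + y = unitVec a + unitVec b := by
      funext j
      have hj : x j ≠ y j ↔ j = a ∨ j = b := by
        have := Finset.ext_iff.1 hs2 j
        simpa using this
      simp only [Pi.add_apply, unitVec]
      by_cases ha : j = a
      · have hb : j ≠ b := fun hb => hab (ha.symm.trans hb)
        have := hj.2 (Or.inl ha)
        rw [if_pos ha, if_neg hb]
        revert this
        generalize x j = p
        generalize y j = q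
        revert p q
        decide
      · by_cases hb : j = b
        · have := hj.2 (Or.inr hb)
          rw [if_neg ha, if_pos hb]
          revert this
          generalize x j = p
          generalize y j = q
          revert p q
          decide
        · have : x j = y j := by
            by_contra hc
            exact (hj.1 hc).elim ha hb
          rw [if_neg ha, if_neg hb, this, CharTwo.add_self_eq_zero, add_zero]
    rw [hxy, map_add, syn_unit, syn_unit] at hs
    exact hab (veq hs)
  obtain ⟨k, hk⟩ := he
  omega

theorem min_dist {τ : Equiv.Perm (V 3)} {x y : Pt 3 → ZMod 2} (hx : x ∈ Scode τ)
    (hy : y ∈ Scode τ) (hne : x ≠ y) : 4 ≤ hammingDist x y := by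
  rw [mem_code] at hx hy
  obtain ⟨a1, a2, a3⟩ := hx
  obtain ⟨b1, b2, b3⟩ := hy
  have pl : par (lh x + lh y) = 0 := by rw [map_add, a1, b1, add_zero]
  have pr : par (rh x + rh y) = 0 := by rw [map_add, a2, b2, add_zero]
  rw [hd_sum]
  by_cases hl : lh x = lh y
  · have hr : rh x ≠ rh y := fun hr => hne (ext_half hl hr)
    have := hd_ham pr (by rw [map_add, ← a3, ← b3, hl, vadd]) hr
    omega
  · by_cases hr : rh x = rh y
    · have hs : syn (lh x) = syn (lh y) := τ.injective (by rw [a3, b3, hr])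
      have := hd_ham pl (by rw [map_add, hs, vadd]) hl
      omega
    · have h1 := hammingDist_pos.2 hl
      have h2 := hammingDist_pos.2 hr
      obtain ⟨k, hk⟩ := hd_even pl
      obtain ⟨m, hm⟩ := hd_even pr
      omega

theorem exists_four {τ : Equiv.Perm (V 3)} (h0 : τ 0 = 0) :
    ∃ x ∈ Scode τ, ∃ y ∈ Scode τ, hammingDist x y = 4 := by
  let w : V 3 → ZMod 2 := fun v => if v 2 = 0 then 1 else 0
  refine ⟨Sum.elim w 0, ?_, 0, zero_mem_code h0, ?_⟩
  · rw [mem_code]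
    have e1 : lh (Sum.elim w 0) = w := rfl
    have e2 : rh (Sum.elim w 0) = 0 := rfl
    have s1 : syn w = 0 := by
      rw [syn_apply]; decide +kernel
    have p1 : par w = 0 := by
      rw [par_apply]; decide +kernel
    rw [e1, e2, s1, p1, h0]
    simp
  · decide +kernel

/-- word with given parity and syndrome -/
def rep (q : ZMod 2) (v : V 3) : V 3 → ZMod 2 := q • unitVec 0 + (unitVec v + unitVec 0)

theorem par_rep (q : ZMod 2) (v : V 3) : par (rep q v) = q := by
  simp [rep, par_unit, zz]

theorem syn_rep (q : ZMod 2) (v : V 3) : syn (rep q v) = v := by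
  simp [rep, syn_unit]

/-- shift by a coset representative -/
def shift (p q : ZMod 2) (v : V 3) : Pt 3 → ZMod 2 := Sum.elim (p • unitVec 0) (rep q v)

theorem lh_shift (p q : ZMod 2) (v : V 3) : lh (shift p q v) = p • unitVec 0 := rfl
theorem rh_shift (p q : ZMod 2) (v : V 3) : rh (shift p q v) = rep q v := rfl

def countEquiv (τ : Equiv.Perm (V 3)) :
    (Scode τ) × (ZMod 2 × ZMod 2 × V 3) ≃ (Pt 3 → ZMod 2) where
  toFun c := c.1.1 + shift c.2.1 c.2.2.1 c.2.2.2
  invFun z := (⟨z + shift (par (lh z)) (par (rh z)) (syn (rh z) + τ (syn (lh z))), by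
      rw [mem_code, lh_add, rh_add, lh_shift, rh_shift]
      simp only [map_add, map_smul, par_unit, syn_unit, par_rep, syn_rep, smul_zero, add_zero,
        smul_eq_mul, mul_one, CharTwo.add_self_eq_zero, true_and]
      rw [← add_assoc, vadd, zero_add]⟩,
    par (lh z), par (rh z), syn (rh z) + τ (syn (lh z)))
  left_inv := by
    rintro ⟨⟨c, hc⟩, p, q, v⟩
    have h := (mem_code τ c).1 hc
    obtain ⟨h1, h2, h3⟩ := h
    have e1 : par (lh (c + shift p q v)) = p := by
      rw [lh_add, lh_shift]; simp [par_unit, h1]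
    have e2 : par (rh (c + shift p q v)) = q := by
      rw [rh_add, rh_shift, map_add, par_rep, h2, zero_add]
    have e3 : syn (rh (c + shift p q v)) + τ (syn (lh (c + shift p q v))) = v := by
      rw [rh_add, lh_add, rh_shift, lh_shift, map_add, map_add, map_smul, syn_unit, smul_zero,
        add_zero, h3, syn_rep, add_comm, ← add_assoc, vadd, zero_add]
    simp only [e1, e2, e3, Prod.mk.injEq, Subtype.mk.injEq, and_true]
    rw [add_assoc, wadd, add_zero]
  right_inv := by
    intro z
    dsimp only
    rw [add_assoc, wadd, add_zero]

theorem card_code (τ : Equiv.Perm (V 3)) :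
    Nat.card (Scode τ) * (2 * Fintype.card (Pt 3)) = 2 ^ Fintype.card (Pt 3) := by
  have h := Nat.card_congr (countEquiv τ)
  rw [Nat.card_prod] at h
  have h1 : Nat.card (ZMod 2 × ZMod 2 × V 3) = 2 * Fintype.card (Pt 3) := by
    simp [Nat.card_eq_fintype_card, ZMod.card]
  have h2 : Nat.card (Pt 3 → ZMod 2) = 2 ^ Fintype.card (Pt 3) := by
    rw [Nat.card_eq_fintype_card, Fintype.card_fun, ZMod.card]
  rw [h1, h2] at h
  exact h

end SC

/-- for every permutation `τ` of `F^3` fixing `0`, the extended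
perfect code `S_τ` of length 16 is neighbor transitive; in particular `Aut(S_τ)`
acts transitively on the codewords and `PAut(S_τ)` acts transitively on the
16 coordinate positions. -/
theorem Scode_length16_neighborTransitive (τ : Equiv.Perm (V 3)) (h0 : τ 0 = 0) :
    IsExtPerfect (Scode τ) ∧ NeighborTransitive (Scode τ) ∧
      IsTransitiveCode (Scode τ) ∧ CoordTransitive (Scode τ) := by
  exact ⟨⟨fun x hx y hy hne => SC.min_dist hx hy hne, SC.exists_four h0, SC.card_code τ⟩,
    SC.nt h0 (SC.good_all τ h0)⟩
end
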